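/- arXiv:1802.10563 — 2 statements merged into one kernel-verified Lean document; each statement's English description precedes it below -/
import Mathlib

section
/- Let N be a norm on ℝ² whose restriction to ℝ² \ {0} is of class C^{2,δ} for some δ ∈ (0,1), and assume the N-unit circle has strictly positive Euclidean curvature at every point. Let A ⊆ ℝ² be ℋ¹-measurable with ℋ¹(A) < ∞. Then A is purely 1-unrectifiable if and only if ℋ¹(P_v(A)) = 0 for ℋ¹-almost every v ∈ S¹. -/
open Set Metric MeasureTheory
open scoped ENNReal RealInnerProductSpace

noncomputable section

namespace BesicovitchFederer

open Filter Topology NNReal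

/-! ### Null sets and derivatives -/

theorem volume_deriv_ne_zero_eq_zero_of_image {f f' : ℝ → ℝ} {B : Set ℝ}
    (hf : ∀ x ∈ B, HasDerivAt f (f' x) x) (hB : volume (f '' B) = 0) :
    volume {x ∈ B | f' x ≠ 0} = 0 := by
  have key (A : ℝ →L[ℝ] ℝ) : ∃ r : ℝ≥0, r ≠ 0 ∧ (A.det ≠ 0 → ∃ m : ℝ≥0, m ≠ 0 ∧
      ∀ s (g : ℝ → ℝ), ApproximatesLinearOn g A s r → m * volume s ≤ volume (g '' s)) := by
    by_cases hA : A.det = 0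
    · exact ⟨1, one_ne_zero, fun h => absurd hA h⟩
    · obtain ⟨m, hm0, hm⟩ : ∃ m : ℝ≥0, 0 < m ∧ (m : ℝ≥0∞) < ENNReal.ofReal |A.det| := by
        have : (0 : ℝ≥0∞) < ENNReal.ofReal |A.det| := by simpa using hA
        obtain ⟨m, h1, h2⟩ := ENNReal.lt_iff_exists_nnreal_btwn.1 this
        exact ⟨m, by exact_mod_cast h1, h2⟩
      obtain ⟨r, hr, hr0⟩ := ((mul_le_addHaar_image_of_lt_det volume A hm).and
        self_mem_nhdsWithin).exists
      exact ⟨r, ne_of_gt hr0, fun _ => ⟨m, hm0.ne', hr⟩⟩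
  choose r hr0 hr using key
  set S := {x ∈ B | f' x ≠ 0} with hS
  obtain ⟨t, A, -, -, hcov, happ, hA⟩ := exists_partition_approximatesLinearOn_of_hasFDerivWithinAt
    f S (fun x => ContinuousLinearMap.toSpanSingleton ℝ (f' x))
    (fun x hx => (hf x hx.1).hasFDerivAt.hasFDerivWithinAt) r hr0
  rcases S.eq_empty_or_nonempty with h | hne
  · simp [h]
  refine measure_mono_null (t := ⋃ n, S ∩ t n) (fun x hx => ?_) (measure_iUnion_null fun n => ?_)
  · obtain ⟨n, hn⟩ := mem_iUnion.1 (hcov hx)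
    exact mem_iUnion.2 ⟨n, hx, hn⟩
  · obtain ⟨y, hy, hAy⟩ := hA hne n
    obtain ⟨m, hm, h⟩ := hr (A n) (by rw [hAy]; simpa using hy.2)
    have h0 : volume (f '' (S ∩ t n)) = 0 :=
      measure_mono_null (image_mono fun x hx => hx.1.1) hB
    have := h _ f (happ n)
    rw [h0, nonpos_iff_eq_zero, mul_eq_zero] at this
    exact this.resolve_left (by exact_mod_cast hm)

theorem hausdorffMeasure_image_eq_zero_of_hasDerivAt_zero {E : Type*} [NormedAddCommGroup E]
    [NormedSpace ℝ E] [SecondCountableTopology E] [MeasurableSpace E] [BorelSpace E]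
    {f : ℝ → E} {B : Set ℝ} (hf : ∀ x ∈ B, HasDerivAt f 0 x) :
    (μH[1] : Measure E) (f '' B) = 0 := by
  have bdd (k : ℕ) (ε : ℝ≥0) (hε : ε ≠ 0) : (μH[1] : Measure E) (f '' (B ∩ Icc (-k : ℝ) k)) ≤
      ε * volume (Icc (-k : ℝ) k) := by
    set S := B ∩ Icc (-k : ℝ) k
    obtain ⟨t, A, hdisj, hmeas, hcov, happ, hA⟩ :=
      exists_partition_approximatesLinearOn_of_hasFDerivWithinAt f S (fun _ => 0)
      (fun x hx => by simpa using (hf x hx.1).hasFDerivAt.hasFDerivWithinAt) (fun _ => ε)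
      (fun _ => hε)
    rcases S.eq_empty_or_nonempty with h | hne
    · simp [h]
    have hlip (n : ℕ) : LipschitzOnWith ε f (S ∩ t n) := by
      obtain ⟨y, -, hy⟩ := hA hne n
      refine LipschitzOnWith.of_dist_le_mul fun x hx z hz => ?_
      have := happ n x hx z hz
      simpa [hy, dist_eq_norm] using this
    calc (μH[1] : Measure E) (f '' S) ≤ (μH[1] : Measure E) (⋃ n, f '' (S ∩ t n)) := by
          refine measure_mono ?_
          rw [← image_iUnion, ← inter_iUnion, inter_eq_left.2 hcov]
      _ ≤ ∑' n, (μH[1] : Measure E) (f '' (S ∩ t n)) := measure_iUnion_le _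
      _ ≤ ∑' n, ε * volume.restrict S (t n) := by
          refine ENNReal.tsum_le_tsum fun n => ?_
          have := (hlip n).hausdorffMeasure_image_le (d := 1) zero_le_one
          rwa [ENNReal.rpow_one, hausdorffMeasure_real, inter_comm S,
            ← Measure.restrict_apply (hmeas n), inter_comm] at this
      _ = ε * volume.restrict S (⋃ n, t n) := by
          rw [ENNReal.tsum_mul_left, measure_iUnion hdisj hmeas]
      _ ≤ ε * volume (Icc (-k : ℝ) k) := by
          refine mul_le_mul_right ?_ _
          calc volume.restrict S (⋃ n, t n) ≤ volume.restrict S univ :=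
                measure_mono (subset_univ _)
            _ = volume S := by simp
            _ ≤ _ := measure_mono inter_subset_right
  have hB : f '' B ⊆ ⋃ k : ℕ, f '' (B ∩ Icc (-k : ℝ) k) := by
    rintro _ ⟨x, hx, rfl⟩
    obtain ⟨k, hk⟩ := exists_nat_ge |x|
    exact mem_iUnion.2 ⟨k, x, ⟨hx, abs_le.1 hk⟩, rfl⟩
  refine measure_mono_null hB (measure_iUnion_null fun k => ?_)
  by_contra hpos
  have hfin : volume (Icc (-k : ℝ) k) ≠ ∞ := measure_Icc_lt_top.ne
  obtain ⟨ε, hε, hlt⟩ := ENNReal.exists_nnreal_pos_mul_lt hfin hpos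
  exact absurd (bdd k ε hε.ne') (not_le.2 hlt)

/-! ### Densities of families of measures on the line -/

theorem measure_ball_le_of_isClosed {m : Measure ℝ} {F : Set ℝ} (hF : IsClosed F) (hmF : m F = 0)
    {c s₀ : ℝ} (hc : 0 ≤ c)
    (h : ∀ t ∈ F, ∀ s, 0 < s → s < s₀ → m (ball t s) ≤ ENNReal.ofReal (c * s))
    {t s : ℝ} (ht : t ∈ F) (hs : 4 * s < s₀) :
    m (ball t s) ≤ ENNReal.ofReal (4 * c) * volume (Fᶜ ∩ closedBall t (2 * s)) := by
  have hFne : F.Nonempty := ⟨t, ht⟩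
  have hd (u : ℝ) (hu : u ∈ ball t s \ F) : 0 < infDist u F ∧ infDist u F < s :=
    ⟨(hF.notMem_iff_infDist_pos hFne).1 hu.2, (infDist_le_dist_of_mem ht).trans_lt hu.1⟩
  obtain ⟨U, hU, hdisj, hcov⟩ := Vitali.exists_disjoint_subfamily_covering_enlargement_closedBall
    (ball t s \ F) id (fun u => infDist u F / 2) s (fun u hu => by linarith [hd u hu]) 5
    (by norm_num)
  have hUc : U.Countable := hdisj.countable_of_nonempty_interior fun u hu => by
    rw [interior_closedBall _ (by linarith [hd u (hU hu)])]
    exact nonempty_ball.2 (by linarith [hd u (hU hu)])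
  have hsub : ball t s ⊆ F ∪ ⋃ u ∈ U, closedBall u (5 * (infDist u F / 2)) := by
    intro u hu
    by_cases huF : u ∈ F
    · exact Or.inl huF
    · obtain ⟨b, hb, hub⟩ := hcov u ⟨hu, huF⟩
      exact Or.inr (mem_biUnion hb (hub (mem_closedBall_self
        (by linarith [hd u ⟨hu, huF⟩]))))
  have hball (u : ℝ) (hu : u ∈ U) : m (closedBall u (5 * (infDist u F / 2))) ≤
      ENNReal.ofReal (4 * c) * volume (closedBall u (infDist u F / 2)) := by
    obtain ⟨h1, h2⟩ := hd u (hU hu)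
    obtain ⟨g, hg, hgu⟩ := hF.exists_infDist_eq_dist hFne u
    have : closedBall u (5 * (infDist u F / 2)) ⊆ ball g (4 * infDist u F) := by
      refine closedBall_subset_ball' ?_
      rw [← hgu]; linarith
    refine (measure_mono this).trans ((h g hg _ (by linarith) (by linarith)).trans ?_)
    rw [Real.volume_closedBall, ← ENNReal.ofReal_mul (by positivity)]
    exact ENNReal.ofReal_le_ofReal (by nlinarith)
  calc m (ball t s) ≤ m F + m (⋃ u ∈ U, closedBall u (5 * (infDist u F / 2))) :=
        (measure_mono hsub).trans (measure_union_le _ _)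
    _ ≤ ∑' u : U, m (closedBall u.1 (5 * (infDist u.1 F / 2))) := by
        rw [hmF, zero_add]; exact measure_biUnion_le _ hUc _
    _ ≤ ∑' u : U, ENNReal.ofReal (4 * c) * volume (closedBall u.1 (infDist u.1 F / 2)) :=
        ENNReal.tsum_le_tsum fun u => hball u.1 u.2
    _ = ENNReal.ofReal (4 * c) * volume (⋃ u ∈ U, closedBall u (infDist u F / 2)) := by
        rw [ENNReal.tsum_mul_left]
        exact congrArg _ (measure_biUnion hUc hdisj fun u _ => measurableSet_closedBall).symm
    _ ≤ _ := by
        gcongr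
        refine iUnion₂_subset fun u hu x hx => ⟨fun hxF => ?_, ?_⟩
        · have := infDist_le_dist_of_mem (x := u) hxF
          rw [mem_closedBall, dist_comm] at hx
          linarith [hd u (hU hu)]
        · have h1 : dist u t < s := (hU hu).1
          have h2 := hd u (hU hu)
          rw [mem_closedBall] at hx ⊢
          linarith [dist_triangle x u t]

theorem ae_measure_ball_le_of_isClosed {ι : Type*} {m : ι → Measure ℝ} {F : Set ℝ}
    (hF : IsClosed F) (hmF : ∀ i, m i F = 0) {c s₀ : ℝ} (hc : 0 ≤ c) (hs₀ : 0 < s₀)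
    (h : ∀ i, ∀ t ∈ F, ∀ s, 0 < s → s < s₀ → m i (ball t s) ≤ ENNReal.ofReal (c * s)) :
    ∀ᵐ t, t ∈ F → ∀ ε > 0, ∃ s₁ > 0, ∀ s, 0 < s → s < s₁ → ∀ i,
      m i (ball t s) ≤ ENNReal.ofReal (ε * s) := by
  filter_upwards [Besicovitch.ae_tendsto_measure_inter_div_of_measurableSet volume
    hF.isOpen_compl.measurableSet] with t ht htF ε hε
  have h0 : (Fᶜ).indicator (1 : ℝ → ℝ≥0∞) t = 0 := by simp [htF]
  rw [h0] at ht
  have hε' : (0 : ℝ≥0∞) < ENNReal.ofReal (ε / (16 * (c + 1))) := by simp; positivity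
  obtain ⟨s₁, hs₁, hlt⟩ := mem_nhdsGT_iff_exists_Ioo_subset.1 (ht (gt_mem_nhds hε'))
  rw [mem_Ioi] at hs₁
  refine ⟨min (s₁ / 2) (s₀ / 4), by positivity, fun s hs hs' i => ?_⟩
  have h1 := lt_of_lt_of_le hs' (min_le_left _ _)
  have h2 := lt_of_lt_of_le hs' (min_le_right _ _)
  have h3 : volume (Fᶜ ∩ closedBall t (2 * s)) / volume (closedBall t (2 * s)) <
      ENNReal.ofReal (ε / (16 * (c + 1))) := hlt (show 2 * s ∈ Ioo 0 s₁ from ⟨by linarith, by linarith⟩)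
  rw [Real.volume_closedBall, ENNReal.div_lt_iff (Or.inl (by simp [hs])) (Or.inl ENNReal.ofReal_ne_top),
    ← ENNReal.ofReal_mul (by positivity)] at h3
  refine (measure_ball_le_of_isClosed hF (hmF i) hc (h i) htF (by linarith)).trans ?_
  refine (mul_le_mul_right h3.le _).trans ?_
  rw [← ENNReal.ofReal_mul (by positivity)]
  refine ENNReal.ofReal_le_ofReal ?_
  have : 4 * c * (ε / (16 * (c + 1)) * (2 * (2 * s))) = (c / (c + 1)) * (ε * s) := by
    field_simp; ring
  rw [this]
  exact mul_le_of_le_one_left (by positivity) (by rw [div_le_one (by positivity)]; linarith)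

theorem ae_measure_ball_le {ι : Type*} {m : ι → Measure ℝ} {G : Set ℝ}
    (hG : MeasurableSet G) (hmG : ∀ i, m i G = 0) {c s₀ : ℝ} (hc : 0 ≤ c) (hs₀ : 0 < s₀)
    (h : ∀ i, ∀ t ∈ G, ∀ s, 0 < s → s < s₀ → m i (ball t s) ≤ ENNReal.ofReal (c * s)) :
    ∀ᵐ t, t ∈ G → ∀ ε > 0, ∃ s₁ > 0, ∀ s, 0 < s → s < s₁ → ∀ i,
      m i (ball t s) ≤ ENNReal.ofReal (ε * s) := by
  have approx (k n : ℕ) : ∃ F ⊆ G ∩ Icc (-k : ℝ) k, IsClosed F ∧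
      volume ((G ∩ Icc (-k : ℝ) k) \ F) < ((n : ℝ≥0∞) + 1)⁻¹ :=
    (hG.inter measurableSet_Icc).exists_isClosed_sdiff_lt
      ((measure_mono inter_subset_right).trans_lt measure_Icc_lt_top).ne (by simp)
  choose F hFG hF hlt using approx
  have hnull (k : ℕ) : volume (⋂ n, (G ∩ Icc (-k : ℝ) k) \ F k n) = 0 := by
    have hlim : Tendsto (fun n : ℕ => ((n : ℝ≥0∞) + 1)⁻¹) atTop (𝓝 0) := by
      have := (tendsto_add_atTop_iff_nat 1).2 ENNReal.tendsto_inv_nat_nhds_zero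
      simpa using this
    exact le_antisymm (ge_of_tendsto' hlim fun n =>
      (measure_mono (iInter_subset _ n)).trans (hlt k n).le) zero_le
  have h1 : ∀ᵐ t, ∀ k : ℕ, t ∉ ⋂ n, (G ∩ Icc (-k : ℝ) k) \ F k n :=
    ae_all_iff.2 fun k => measure_eq_zero_iff_ae_notMem.1 (hnull k)
  have h2 := ae_all_iff.2 fun k => ae_all_iff.2 fun n =>
    ae_measure_ball_le_of_isClosed (hF k n)
      (m := m) (fun i => measure_mono_null ((hFG k n).trans inter_subset_left) (hmG i)) hc hs₀
      (fun i t ht => h i t (hFG k n ht).1)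
  filter_upwards [h1, h2] with t ht1 ht2 htG
  obtain ⟨k, hk⟩ := exists_nat_ge |t|
  have := ht1 k
  simp only [mem_iInter, not_forall] at this
  obtain ⟨n, hn⟩ := this
  refine ht2 k n ?_
  by_contra hnF
  exact hn ⟨⟨htG, abs_le.1 hk⟩, hnF⟩

/-! ### Sheared projections and cones -/

/-- The plane with its Euclidean metric. -/
abbrev Plane := EuclideanSpace ℝ (Fin 2)

/-- The linear projection of the plane to the line whose fibres are the lines of slope `t`. -/
def shear (t : ℝ) (p : Plane) : ℝ := p 1 - t * p 0

/-- The part of the cone with vertex `a`, slope `t` and aperture `s` at horizontal distance less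
than `r` from `a`. -/
def cone (a : Plane) (r t s : ℝ) : Set Plane :=
  {p | |p 0 - a 0| < r ∧ |shear t p - shear t a| < s * |p 0 - a 0|}

/-- The set `E` is, up to `μ`-null sets, disjoint from all Lipschitz curves. -/
def CurveNull (μ : Measure Plane) (E : Set Plane) : Prop :=
  ∀ f : ℝ → Plane, (∃ c : ℝ≥0, LipschitzWith c f) → μ (E ∩ range f) = 0

theorem CurveNull.mono {μ : Measure Plane} {E F : Set Plane} (h : CurveNull μ F) (hEF : E ⊆ F) :
    CurveNull μ E :=
  fun f hf => measure_mono_null (inter_subset_inter_left _ hEF) (h f hf)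

theorem exists_lipschitzWith_shear (t : ℝ) : ∃ C : ℝ≥0, LipschitzWith C (shear t) := by
  let φ : Plane →L[ℝ] ℝ := EuclideanSpace.proj 1 - t • EuclideanSpace.proj 0
  exact ⟨_, φ.lipschitz⟩

theorem exists_curve_of_shear_bound {t c : ℝ} {E : Set Plane}
    (h : ∀ x ∈ E, ∀ y ∈ E, |y 0 - x 0| ≤ c * |shear t y - shear t x|) :
    ∃ f : ℝ → Plane, (∃ C : ℝ≥0, LipschitzWith C f) ∧ E ⊆ range f := by
  let ψ : ℝ → Plane := Function.invFunOn (shear t) E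
  have hψ (u : ℝ) (hu : u ∈ shear t '' E) : ψ u ∈ E ∧ shear t (ψ u) = u :=
    Function.invFunOn_pos hu
  have hlip : LipschitzOnWith c.toNNReal (fun u => ψ u 0) (shear t '' E) := by
    refine LipschitzOnWith.of_dist_le_mul fun u hu v hv => ?_
    have := h _ (hψ v hv).1 _ (hψ u hu).1
    rw [(hψ v hv).2, (hψ u hu).2] at this
    rw [Real.dist_eq, Real.dist_eq]
    exact this.trans (mul_le_mul_of_nonneg_right (Real.le_coe_toNNReal c) (abs_nonneg _))
  obtain ⟨g, hg, hgE⟩ := hlip.extend_real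
  refine ⟨fun u => ContinuousLinearMap.toSpanSingleton ℝ (!₂[1, t] : Plane) (g u) +
    ContinuousLinearMap.toSpanSingleton ℝ (!₂[0, 1] : Plane) u,
    ⟨_, ((ContinuousLinearMap.lipschitz _).comp hg).add (ContinuousLinearMap.lipschitz _)⟩,
    fun x hx => ⟨shear t x, ?_⟩⟩
  have hu : shear t x ∈ shear t '' E := ⟨x, hx, rfl⟩
  have hgx : g (shear t x) = x 0 := by
    rw [← hgE hu]
    have := h _ hx _ (hψ _ hu).1
    rw [(hψ _ hu).2, sub_self, abs_zero, mul_zero] at this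
    exact sub_eq_zero.1 (abs_nonpos_iff.1 this)
  ext i
  fin_cases i
  · simp [hgx]
  · simp only [hgx]; simp [shear]; ring

theorem inter_strip_subset_cone_union {t s h : ℝ} {E : Set Plane} {x y : Plane} (hs : 0 < s)
    (hh : 0 < h) (hxy : |shear t y - shear t x| < s / 4 * |y 0 - x 0|) (hhy : h / 2 < |y 0 - x 0|)
    (hyh : |y 0 - x 0| ≤ h)
    (hmax : ∀ z ∈ E, |shear t z - shear t x| < s / 4 * |z 0 - x 0| → |z 0 - x 0| ≤ h) :
    {p ∈ E | |shear t p - shear t x| ≤ s * h / 8} ⊆ cone x (2 * h) t s ∪ cone y (3 * h) t s := by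
  rintro p ⟨hp, hpx⟩
  have hph : |p 0 - x 0| ≤ h := by
    by_contra! hlt
    exact absurd (hmax p hp (hpx.trans_lt (by nlinarith))) (not_le.2 hlt)
  have htri : |y 0 - x 0| ≤ |p 0 - x 0| + |p 0 - y 0| := by
    rw [abs_sub_comm (p 0) (y 0), add_comm]; exact abs_sub_le _ _ _
  have htri' : |p 0 - y 0| ≤ |p 0 - x 0| + |y 0 - x 0| := by
    rw [abs_sub_comm (y 0) (x 0)]; exact abs_sub_le _ _ _
  have hsh : |shear t p - shear t y| ≤ |shear t p - shear t x| + |shear t y - shear t x| := by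
    rw [abs_sub_comm (shear t y) (shear t x)]; exact abs_sub_le _ _ _
  rcases le_or_gt (|y 0 - x 0| / 2) |p 0 - x 0| with hc | hc
  · exact Or.inl ⟨by linarith, hpx.trans_lt (by nlinarith)⟩
  · refine Or.inr ⟨by linarith, hsh.trans_lt ?_⟩
    nlinarith

theorem measure_le_of_cone_bound {μ : Measure Plane} {E : Set Plane} {t s d η R : ℝ} (hs : 0 < s)
    (hs1 : s ≤ 1) (hη : 0 ≤ η) (hdiam : ∀ x ∈ E, ∀ y ∈ E, |y 0 - x 0| < d)
    (hR : ∀ x ∈ E, |shear t x| ≤ R)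
    (hcone : ∀ x ∈ E, ∀ r, 0 < r → r < 4 * d → μ (cone x r t s) ≤ ENNReal.ofReal (η * r * s))
    (hpu : CurveNull μ E) :
    μ E ≤ ENNReal.ofReal (200 * η * (R + d)) := by
  set E₁ := {x ∈ E | ∃ y ∈ E, |shear t y - shear t x| < s / 4 * |y 0 - x 0|} with hE₁
  have hE₀ : μ (E \ E₁) = 0 := by
    obtain ⟨f, hf, hsub⟩ := exists_curve_of_shear_bound (t := t) (c := 4 / s) (E := E \ E₁)
      fun x hx y hy => by
        have : ¬ |shear t y - shear t x| < s / 4 * |y 0 - x 0| :=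
          fun hlt => hx.2 ⟨hx.1, y, hy.1, hlt⟩
        rw [div_mul_eq_mul_div, le_div_iff₀ hs]
        linarith [not_lt.1 this]
    exact measure_mono_null (subset_inter sdiff_subset hsub) (hpu f hf)
  have hh : ∀ x ∈ E₁, ∃ h, 0 < h ∧ h ≤ d ∧ ∃ y ∈ E,
      |shear t y - shear t x| < s / 4 * |y 0 - x 0| ∧ h / 2 < |y 0 - x 0| ∧ |y 0 - x 0| ≤ h ∧
      ∀ z ∈ E, |shear t z - shear t x| < s / 4 * |z 0 - x 0| → |z 0 - x 0| ≤ h := by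
    rintro x ⟨hx, y, hy, hxy⟩
    set S := (fun y : Plane => |y 0 - x 0|) ''
      {y ∈ E | |shear t y - shear t x| < s / 4 * |y 0 - x 0|}
    have hbdd : BddAbove S := ⟨d, by rintro _ ⟨z, hz, rfl⟩; exact (hdiam x hx z hz.1).le⟩
    have hne : S.Nonempty := ⟨_, y, ⟨hy, hxy⟩, rfl⟩
    have hle : ∀ z ∈ E, |shear t z - shear t x| < s / 4 * |z 0 - x 0| → |z 0 - x 0| ≤ sSup S :=
      fun z hz hzx => le_csSup hbdd ⟨z, ⟨hz, hzx⟩, rfl⟩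
    have hpos : 0 < sSup S := by
      refine lt_of_lt_of_le ?_ (hle y hy hxy)
      have := (abs_nonneg _).trans_lt hxy
      exact pos_of_mul_pos_right this (by positivity)
    obtain ⟨_, ⟨z, ⟨hz, hzx⟩, rfl⟩, hlt⟩ := exists_lt_of_lt_csSup hne (half_lt_self hpos)
    exact ⟨sSup S, hpos, csSup_le hne (by rintro _ ⟨z, hz, rfl⟩; exact (hdiam x hx z hz.1).le),
      z, hz, hzx, hlt, hle z hz hzx, hle⟩
  choose! h hpos hd y hyE hyx hhy hyh hmax using hh
  set cyl : Plane → Set Plane := fun x => {p ∈ E | |shear t p - shear t x| ≤ s * h x / 8} with hcyl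
  have hcylμ : ∀ x ∈ E₁, μ (cyl x) ≤
      ENNReal.ofReal (100 * η) * volume (closedBall (shear t x) (s * h x / 40)) := by
    intro x hx
    have h0 := hpos x hx
    have h1 := hd x hx
    calc μ (cyl x) ≤ μ (cone x (2 * h x) t s) + μ (cone (y x) (3 * h x) t s) :=
          (measure_mono (inter_strip_subset_cone_union hs h0 (hyx x hx) (hhy x hx) (hyh x hx)
            (hmax x hx))).trans (measure_union_le _ _)
      _ ≤ ENNReal.ofReal (η * (2 * h x) * s) + ENNReal.ofReal (η * (3 * h x) * s) :=
          add_le_add (hcone x hx.1 _ (by linarith) (by linarith))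
            (hcone _ (hyE x hx) _ (by linarith) (by linarith))
      _ = _ := by
          rw [← ENNReal.ofReal_add (by positivity) (by positivity), Real.volume_closedBall,
            ← ENNReal.ofReal_mul (by positivity)]
          congr 1; ring
  obtain ⟨U, hU, hdisj, hcov⟩ := Vitali.exists_disjoint_subfamily_covering_enlargement_closedBall
    E₁ (shear t) (fun x => s * h x / 40) d (fun x hx => by nlinarith [hpos x hx, hd x hx]) 5
    (by norm_num)
  have hrad : ∀ x ∈ U, 0 < s * h x / 40 := fun x hx => by
    have := hpos x (hU hx); positivity
  have hUc : U.Countable := hdisj.countable_of_nonempty_interior fun x hx => by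
    rw [interior_closedBall _ (hrad x hx).ne']
    exact nonempty_ball.2 (hrad x hx)
  have hsub : E ⊆ (E \ E₁) ∪ ⋃ x ∈ U, cyl x := by
    intro x hx
    by_cases hx1 : x ∈ E₁
    · obtain ⟨b, hb, hxb⟩ := hcov x hx1
      have h0 := hpos x hx1
      have := hxb (mem_closedBall_self (by positivity))
      rw [mem_closedBall, Real.dist_eq] at this
      exact Or.inr (mem_biUnion hb ⟨hx, by linarith⟩)
    · exact Or.inl ⟨hx, hx1⟩
  calc μ E ≤ μ (E \ E₁) + μ (⋃ x ∈ U, cyl x) := (measure_mono hsub).trans (measure_union_le _ _)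
    _ ≤ ∑' x : U, μ (cyl x) := by
        rw [hE₀, zero_add]; exact measure_biUnion_le _ hUc _
    _ ≤ ∑' x : U, ENNReal.ofReal (100 * η) *
          volume (closedBall (shear t x) (s * h x / 40)) :=
        ENNReal.tsum_le_tsum fun x => hcylμ x.1 (hU x.2)
    _ = ENNReal.ofReal (100 * η) *
          volume (⋃ x ∈ U, closedBall (shear t x) (s * h x / 40)) := by
        rw [ENNReal.tsum_mul_left]
        exact congrArg _ (measure_biUnion hUc hdisj fun u _ => measurableSet_closedBall).symm
    _ ≤ ENNReal.ofReal (100 * η) * volume (closedBall (0 : ℝ) (R + d)) := by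
        refine mul_le_mul_right (measure_mono (iUnion₂_subset fun x hx => ?_)) _
        refine closedBall_subset_closedBall' ?_
        have h0 := hpos x (hU hx)
        have h1 := hd x (hU hx)
        have h2 := hR x (hU hx).1
        rw [dist_zero_right, Real.norm_eq_abs]
        nlinarith
    _ = _ := by
        rw [Real.volume_closedBall, ← ENNReal.ofReal_mul (by positivity)]
        congr 1; ring

/-- The cones of slope `t` at `x` of radius less than `δ` have `μ`-measure that is uniformly small
relative to their size, as the aperture tends to zero. -/
def ThinCones (μ : Measure Plane) (δ : ℝ) (x : Plane) (t : ℝ) : Prop :=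
  ∀ k : ℕ, ∃ n : ℕ, ∀ s r : ℚ, 0 < s → (s : ℝ) < 1 / (n + 1) → 0 < r → (r : ℝ) < δ →
    μ (cone x r t s) ≤ ENNReal.ofReal (1 / (k + 1) * r * s)

theorem cone_mono {a : Plane} {r r' t s s' : ℝ} (hr : r ≤ r') (hs : s ≤ s') :
    cone a r t s ⊆ cone a r' t s' :=
  fun _ hp => ⟨hp.1.trans_le hr, hp.2.trans_le (mul_le_mul_of_nonneg_right hs (abs_nonneg _))⟩

theorem measure_eq_zero_of_thinCones {μ : Measure Plane} {E : Set Plane} {t δ R : ℝ} (hδ : 0 < δ)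
    (hR : ∀ x ∈ E, |shear t x| ≤ R) (hthin : ∀ x ∈ E, ThinCones μ δ x t) (hpu : CurveNull μ E) :
    μ E = 0 := by
  set d := δ / 4 with hd
  have hd0 : 0 < d := by positivity
  let Q : ℤ → Set Plane := fun j => {p | ⌊p 0 / d⌋ = j}
  have hQ (j : ℤ) (x : Plane) (hx : x ∈ Q j) (y : Plane) (hy : y ∈ Q j) : |y 0 - x 0| < d := by
    have h := Int.abs_sub_lt_one_of_floor_eq_floor
      (show ⌊y 0 / d⌋ = ⌊x 0 / d⌋ from Eq.trans hy (Eq.symm hx))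
    rwa [← _root_.sub_div, abs_div, abs_of_pos hd0, div_lt_one hd0] at h
  let S : ℕ → ℕ → Set Plane := fun k n => {x | ∀ s r : ℚ, 0 < s → (s : ℝ) < 1 / (n + 1) → 0 < r →
    (r : ℝ) < δ → μ (cone x r t s) ≤ ENNReal.ofReal (1 / (k + 1) * r * s)}
  have hS (k n : ℕ) (j : ℤ) : μ (E ∩ Q j ∩ S k n) ≤
      ENNReal.ofReal (400 * (R + d) * (1 / ((k : ℝ) + 1))) := by
    obtain ⟨s, hs0, hs1⟩ := exists_rat_btwn (show (0 : ℝ) < 1 / ((n : ℝ) + 1) by positivity)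
    have hs1' : (s : ℝ) ≤ 1 := hs1.le.trans (by
      rw [div_le_one (by positivity)]; linarith [Nat.cast_nonneg (α := ℝ) n])
    refine (measure_le_of_cone_bound (η := 2 * (1 / ((k : ℝ) + 1))) (d := d) (R := R) (t := t)
      hs0 hs1' (by positivity) (fun x hx y hy => hQ j x hx.1.2 y hy.1.2)
      (fun x hx => hR x hx.1.1) (fun x hx r hr0 hr => ?_)
      (hpu.mono fun x hx => hx.1.1)).trans (ENNReal.ofReal_le_ofReal (le_of_eq (by ring)))
    obtain ⟨q, hq1, hq2⟩ := exists_rat_btwn (show r < min (2 * r) δ from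
      lt_min (by linarith) (by linarith))
    have hq3 := hq2.trans_le (min_le_left _ _)
    refine (measure_mono (cone_mono hq1.le le_rfl)).trans ((hx.2 s q (by exact_mod_cast hs0) hs1
      (by exact_mod_cast hr0.trans hq1) (hq2.trans_le (min_le_right _ _))).trans
      (ENNReal.ofReal_le_ofReal ?_))
    have : 2 * (1 / ((k : ℝ) + 1)) * r * s = 1 / ((k : ℝ) + 1) * (2 * r) * s := by ring
    rw [this]
    gcongr
  have hmono (k : ℕ) : Monotone (S k) := fun n m hnm x hx s r hs hs' => hx s r hs
    (hs'.trans_le (by gcongr))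
  have hEQ (j : ℤ) : μ (E ∩ Q j) = 0 := by
    have hk (k : ℕ) : μ (E ∩ Q j) ≤ ENNReal.ofReal (400 * (R + d) * (1 / ((k : ℝ) + 1))) := by
      have hcov : E ∩ Q j = ⋃ n, E ∩ Q j ∩ S k n := by
        rw [← inter_iUnion, eq_comm, inter_eq_left]
        exact fun x hx => mem_iUnion.2 (hthin x hx.1 k)
      have hdir : Directed (· ⊆ ·) fun n => E ∩ Q j ∩ S k n :=
        Monotone.directed_le (f := fun n => E ∩ Q j ∩ S k n)
          fun n m hnm => inter_subset_inter_right _ (hmono k hnm)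
      rw [hcov, hdir.measure_iUnion]
      exact iSup_le fun n => hS k n j
    have hlim : Tendsto (fun k : ℕ => ENNReal.ofReal (400 * (R + d) * (1 / ((k : ℝ) + 1)))) atTop
        (𝓝 0) := by
      have := ENNReal.tendsto_ofReal
        ((tendsto_one_div_add_atTop_nhds_zero_nat (𝕜 := ℝ)).const_mul (400 * (R + d)))
      simpa using this
    exact le_antisymm (ge_of_tendsto' hlim hk) zero_le
  refine measure_mono_null (fun x hx => ?_) (measure_iUnion_null hEQ)
  exact mem_iUnion.2 ⟨⌊x 0 / d⌋, hx, rfl⟩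

/-- At the scales `r < δ`, the cones of slope `t` at `x` have `μ`-measure that is unboundedly large
relative to their size, as the aperture tends to zero. -/
def FatCones (μ : Measure Plane) (δ : ℝ) (x : Plane) (t : ℝ) : Prop :=
  ∀ k : ℕ, ∃ s r : ℚ, (0 < s ∧ (s : ℝ) < 1 / (k + 1) ∧ 0 < r ∧ (r : ℝ) < δ) ∧
    ENNReal.ofReal (k * r * s) < μ (cone x r t s)

/-- The line of slope `t` through `x` meets `K` in another point, at horizontal distance at most `δ`
from `x`. -/
def LineMeets (K : Set Plane) (δ : ℝ) (x : Plane) (t : ℝ) : Prop :=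
  ∃ p ∈ K, 0 < |p 0 - x 0| ∧ |p 0 - x 0| ≤ δ ∧ shear t p = shear t x

theorem continuous_shear (t : ℝ) : Continuous (shear t) := by
  unfold shear; fun_prop

theorem volume_shear_image_eq_zero {t : ℝ} {E : Set Plane} (h : (μH[1] : Measure Plane) E = 0) :
    volume (shear t '' E) = 0 := by
  obtain ⟨C, hC⟩ := exists_lipschitzWith_shear t
  have := hC.hausdorffMeasure_image_le (d := 1) zero_le_one E
  rw [h, mul_zero, hausdorffMeasure_real] at this
  exact le_antisymm this zero_le

theorem volume_shear_fatCones {μ : Measure Plane} [IsFiniteMeasure μ] {t δ : ℝ} :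
    volume (shear t '' {x | FatCones μ δ x t}) = 0 := by
  set ν := μ.map (shear t)
  rw [measure_eq_zero_iff_ae_notMem]
  filter_upwards [Besicovitch.ae_tendsto_rnDeriv ν volume, ν.rnDeriv_lt_top volume] with y hy hlt
  rintro ⟨x, hx, rfl⟩
  obtain ⟨c, hc1, hc2⟩ := ENNReal.lt_iff_exists_nnreal_btwn.1 hlt
  obtain ⟨ρ, hρ, hsub⟩ := mem_nhdsGT_iff_exists_Ioo_subset.1 (hy (gt_mem_nhds hc1))
  rw [mem_Ioi] at hρ
  obtain ⟨k, hk⟩ := exists_nat_gt (max (2 * c : ℝ) (δ / ρ))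
  have hk1 := (le_max_left _ _).trans_lt hk
  have hk2 := (le_max_right _ _).trans_lt hk
  obtain ⟨s, r, ⟨hs, hsk, hr, hrδ⟩, hfat⟩ := hx k
  have hs' : (0 : ℝ) < s := by exact_mod_cast hs
  have hr' : (0 : ℝ) < r := by exact_mod_cast hr
  have hrs : (r * s : ℝ) < ρ := by
    rw [lt_div_iff₀ (by positivity)] at hsk
    rw [div_lt_iff₀ hρ] at hk2
    nlinarith
  have hmem : ν (closedBall (shear t x) (r * s)) / volume (closedBall (shear t x) (r * s)) < c :=
    hsub (show (r * s : ℝ) ∈ Ioo 0 ρ from ⟨by positivity, hrs⟩)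
  have hpos : (0 : ℝ) < 2 * (r * s) := by positivity
  rw [Real.volume_closedBall, ENNReal.div_lt_iff (Or.inl (by simpa using hpos))
    (Or.inl ENNReal.ofReal_ne_top)] at hmem
  have hcone : μ (cone x r t s) ≤ ν (closedBall (shear t x) (r * s)) := by
    rw [Measure.map_apply (continuous_shear t).measurable measurableSet_closedBall]
    refine measure_mono fun p hp => ?_
    rw [mem_preimage, mem_closedBall, Real.dist_eq]
    exact hp.2.le.trans (by nlinarith [hp.1])
  have hfin := (hfat.trans_le hcone).trans hmem
  rw [← ENNReal.ofReal_coe_nnreal, ← ENNReal.ofReal_mul (by positivity)] at hfin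
  have := (ENNReal.ofReal_lt_ofReal_iff_of_nonneg (by positivity)).1 hfin
  nlinarith [mul_lt_mul_of_pos_right hk1 (mul_pos hr' hs')]

theorem volume_infinite_fibres {K : Set Plane} (hK : (μH[1] : Measure Plane) K ≠ ∞) (t : ℝ) :
    volume {y | {p ∈ K | shear t p = y}.Infinite} = 0 := by
  obtain ⟨C, hC⟩ := exists_lipschitzWith_shear t
  let Q : ℕ → ℤ → Set Plane := fun n j => {p | ⌊((n : ℝ) + 1) * p 0⌋ = j}
  have hQm (n : ℕ) (j : ℤ) : MeasurableSet (Q n j) := by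
    have : Measurable fun p : Plane => ⌊((n : ℝ) + 1) * p 0⌋ := by fun_prop
    exact this (measurableSet_singleton j)
  let T : ℕ → ℤ → Set ℝ := fun n j => toMeasurable volume (shear t '' (K ∩ Q n j))
  let g : ℕ → ℝ → ℝ≥0∞ := fun n y => ∑' j, (T n j).indicator 1 y
  have hg (n : ℕ) : Measurable (g n) := Measurable.tsum fun j =>
    measurable_one.indicator (measurableSet_toMeasurable _ _)
  have hint (n : ℕ) : ∫⁻ y, g n y ≤ C * (μH[1] : Measure Plane) K := by
    calc ∫⁻ y, g n y = ∑' j, volume (shear t '' (K ∩ Q n j)) := by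
          rw [lintegral_tsum fun j =>
            (measurable_one.indicator (measurableSet_toMeasurable _ _)).aemeasurable]
          refine tsum_congr fun j => ?_
          rw [lintegral_indicator_one (measurableSet_toMeasurable _ _), measure_toMeasurable]
      _ ≤ ∑' j, C * (μH[1] : Measure Plane).restrict K (Q n j) := by
          refine ENNReal.tsum_le_tsum fun j => ?_
          have := hC.hausdorffMeasure_image_le (d := 1) zero_le_one (K ∩ Q n j)
          rwa [ENNReal.rpow_one, hausdorffMeasure_real, inter_comm K,
            ← Measure.restrict_apply (hQm n j), inter_comm] at this
      _ = C * (μH[1] : Measure Plane).restrict K (⋃ j, Q n j) := by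
          rw [ENNReal.tsum_mul_left, measure_iUnion _ (hQm n)]
          exact fun i j hij => disjoint_left.2 fun p hi hj => hij (Eq.trans (Eq.symm hi) hj)
      _ ≤ C * (μH[1] : Measure Plane).restrict K univ :=
          mul_le_mul_right (measure_mono (subset_univ _)) _
      _ = _ := by rw [Measure.restrict_apply_univ]
  have hfin : ∫⁻ y, liminf (fun n => g n y) atTop ≠ ∞ := by
    have h1 : ∫⁻ y, liminf (fun n => g n y) atTop ≤ C * (μH[1] : Measure Plane) K :=
      (lintegral_liminf_le hg).trans ((liminf_le_liminf (Eventually.of_forall hint)).trans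
        (by simp))
    exact (h1.trans_lt (ENNReal.mul_lt_top ENNReal.coe_lt_top hK.lt_top)).ne
  rw [measure_eq_zero_iff_ae_notMem]
  filter_upwards [ae_lt_top (Measurable.liminf hg) hfin] with y hy hinf
  refine hy.ne (ENNReal.eq_top_of_forall_nnreal_le fun r => ?_)
  obtain ⟨N, hN⟩ := exists_nat_ge r
  obtain ⟨F, hF, hcard⟩ := hinf.exists_subset_card_eq N
  have hsep : ∀ᶠ n : ℕ in atTop, ∀ p ∈ F, ∀ q ∈ F, p ≠ q →
      ⌊((n : ℝ) + 1) * p 0⌋ ≠ ⌊((n : ℝ) + 1) * q 0⌋ := by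
    rw [Filter.eventually_all_finset]
    intro p hp
    rw [Filter.eventually_all_finset]
    intro q hq
    by_cases hpq : p = q
    · exact Eventually.of_forall fun _ h => absurd hpq h
    have h0 : 0 < |p 0 - q 0| := by
      rw [abs_pos, sub_ne_zero]
      intro h0
      have h1 : shear t p = shear t q := (hF hp).2.trans (hF hq).2.symm
      refine hpq (PiLp.ext fun i => ?_)
      fin_cases i
      · exact h0
      · simpa [shear, h0] using h1
    obtain ⟨M, hM⟩ := exists_nat_gt (1 / |p 0 - q 0|)
    filter_upwards [eventually_ge_atTop M] with n hn _ heq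
    have h2 := Int.abs_sub_lt_one_of_floor_eq_floor heq
    rw [← mul_sub, abs_mul, abs_of_pos (by positivity)] at h2
    rw [div_lt_iff₀ h0] at hM
    have h3 : (M : ℝ) ≤ n := by exact_mod_cast hn
    nlinarith
  refine le_liminf_of_le (by isBoundedDefault) ?_
  filter_upwards [hsep] with n hn
  have hinj : Set.InjOn (fun p : Plane => ⌊((n : ℝ) + 1) * p 0⌋) F := fun p hp q hq h => by
    by_contra hpq
    exact hn p hp q hq hpq h
  calc (r : ℝ≥0∞) ≤ (N : ℝ≥0∞) := by exact_mod_cast hN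
    _ = ∑ p ∈ F, (1 : ℝ≥0∞) := by simp [hcard]
    _ = ∑ p ∈ F, (T n ⌊((n : ℝ) + 1) * p 0⌋).indicator 1 y := by
        refine Finset.sum_congr rfl fun p hp => ?_
        rw [indicator_of_mem, Pi.one_apply]
        exact subset_toMeasurable _ _ ⟨p, ⟨(hF hp).1, rfl⟩, (hF hp).2⟩
    _ = ∑ j ∈ F.image (fun p : Plane => ⌊((n : ℝ) + 1) * p 0⌋), (T n j).indicator 1 y :=
        (Finset.sum_image (f := fun j => (T n j).indicator 1 y) hinj).symm
    _ ≤ g n y := ENNReal.sum_le_tsum _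

theorem infinite_fibre_of_lineMeets {K : Set Plane} {x : Plane} {t : ℝ}
    (h : ∀ j : ℕ, LineMeets K (1 / (j + 1)) x t) :
    {p ∈ K | shear t p = shear t x}.Infinite := by
  intro hfin
  have hev : ∀ᶠ j : ℕ in atTop, ∀ p ∈ {p ∈ K | shear t p = shear t x}, 0 < |p 0 - x 0| →
      1 / ((j : ℝ) + 1) < |p 0 - x 0| := by
    rw [Filter.eventually_all_finite hfin]
    intro p _
    by_cases h0 : 0 < |p 0 - x 0|
    · filter_upwards [tendsto_one_div_add_atTop_nhds_zero_nat.eventually (gt_mem_nhds h0)]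
        with j hj _ using hj
    · exact Eventually.of_forall fun _ h => absurd h h0
  obtain ⟨j, hj⟩ := hev.exists
  obtain ⟨p, hp, h0, hle, hpx⟩ := h j
  exact absurd (hj p ⟨hp, hpx⟩ h0) (not_lt.2 hle)

/-! ### The trichotomy for almost every slope -/

theorem measurable_measure_cone (μ : Measure Plane) [SFinite μ] (r s : ℝ) :
    Measurable fun z : Plane × ℝ => μ (cone z.1 r z.2 s) := by
  have hopen : IsOpen {w : (Plane × ℝ) × Plane | w.2 ∈ cone w.1.1 r w.1.2 s} := by
    have h1 : IsOpen {w : (Plane × ℝ) × Plane | |w.2 0 - w.1.1 0| < r} :=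
      isOpen_lt (by fun_prop) (by fun_prop)
    have h2 : IsOpen {w : (Plane × ℝ) × Plane |
        |shear w.1.2 w.2 - shear w.1.2 w.1.1| < s * |w.2 0 - w.1.1 0|} :=
      isOpen_lt (by unfold shear; fun_prop) (by fun_prop)
    exact h1.inter h2
  exact measurable_measure_prodMk_left hopen.measurableSet

theorem measurableSet_fatCones (μ : Measure Plane) [SFinite μ] (δ : ℝ) :
    MeasurableSet {z : Plane × ℝ | FatCones μ δ z.1 z.2} :=
  measurableSet_setOfPred.2 <| Measurable.forall fun _ => Measurable.exists fun s =>
    Measurable.exists fun r => measurable_const.and <| measurableSet_setOfPred.1 <|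
      measurableSet_lt measurable_const (measurable_measure_cone μ r s)

theorem measurableSet_cone_bound (μ : Measure Plane) [SFinite μ] (δ c s₀ : ℝ) :
    MeasurableSet {z : Plane × ℝ | ∀ s r : ℚ, 0 < s → (s : ℝ) < s₀ → 0 < r → (r : ℝ) < δ →
      μ (cone z.1 r z.2 s) ≤ ENNReal.ofReal (c * r * s)} :=
  measurableSet_setOfPred.2 <| Measurable.forall fun s => Measurable.forall fun r =>
    measurable_const.imp <| measurable_const.imp <| measurable_const.imp <| measurable_const.imp <|
      measurableSet_setOfPred.1 <| measurableSet_le (measurable_measure_cone μ r s) measurable_const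

theorem measurableSet_thinCones (μ : Measure Plane) [SFinite μ] (δ : ℝ) :
    MeasurableSet {z : Plane × ℝ | ThinCones μ δ z.1 z.2} :=
  measurableSet_setOfPred.2 <| Measurable.forall fun k => Measurable.exists fun n =>
    measurableSet_setOfPred.1 (measurableSet_cone_bound μ δ (1 / (k + 1)) (1 / (n + 1)))

theorem measurableSet_lineMeets {K : Set Plane} (hK : IsCompact K) (δ : ℝ) :
    MeasurableSet {z : Plane × ℝ | LineMeets K δ z.1 z.2} := by
  have : CompactSpace K := isCompact_iff_compactSpace.1 hK
  let Z : ℕ → Set ((Plane × ℝ) × K) := fun n => {w | 1 / ((n : ℝ) + 1) ≤ |w.2.1 0 - w.1.1 0| ∧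
    |w.2.1 0 - w.1.1 0| ≤ δ ∧ shear w.1.2 w.2.1 = shear w.1.2 w.1.1}
  have hZ (n : ℕ) : IsClosed (Z n) := by
    have h1 : IsClosed {w : (Plane × ℝ) × K | 1 / ((n : ℝ) + 1) ≤ |w.2.1 0 - w.1.1 0|} :=
      isClosed_le (by fun_prop) (by fun_prop)
    have h2 : IsClosed {w : (Plane × ℝ) × K | |w.2.1 0 - w.1.1 0| ≤ δ} :=
      isClosed_le (by fun_prop) (by fun_prop)
    have h3 : IsClosed {w : (Plane × ℝ) × K | shear w.1.2 w.2.1 = shear w.1.2 w.1.1} :=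
      isClosed_eq (by unfold shear; fun_prop) (by unfold shear; fun_prop)
    exact h1.inter (h2.inter h3)
  have heq : {z : Plane × ℝ | LineMeets K δ z.1 z.2} = ⋃ n, Prod.fst '' Z n := by
    ext z
    simp only [mem_ofPred_eq, mem_iUnion, mem_image]
    constructor
    · rintro ⟨p, hp, h0, hle, hpz⟩
      obtain ⟨n, hn⟩ := exists_nat_one_div_lt h0
      exact ⟨n, (z, ⟨p, hp⟩), ⟨hn.le, hle, hpz⟩, rfl⟩
    · rintro ⟨n, w, ⟨h0, hle, hpz⟩, rfl⟩
      exact ⟨w.2.1, w.2.2, lt_of_lt_of_le (by positivity) h0, hle, hpz⟩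
  rw [heq]
  exact MeasurableSet.iUnion fun n => (isClosedMap_fst_of_compactSpace _ (hZ n)).measurableSet

theorem ae_lineMeets_or_fatCones_or_thinCones {K : Set Plane} (hK : IsCompact K) {μ : Measure Plane}
    [IsFiniteMeasure μ] (hμK : μ Kᶜ = 0) (δ : ℝ) (x : Plane) :
    ∀ᵐ t, LineMeets K δ x t ∨ FatCones μ δ x t ∨ ThinCones μ δ x t := by
  let σ : Plane → ℝ := fun p => (p 1 - x 1) / (p 0 - x 0)
  have hσ : Measurable σ := by fun_prop
  let D : ℝ → Set Plane := fun q => {p | 0 < |p 0 - x 0| ∧ |p 0 - x 0| < q}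
  have hshear (t : ℝ) (p : Plane) (hp : 0 < |p 0 - x 0|) :
      shear t p - shear t x = (σ p - t) * (p 0 - x 0) := by
    have := abs_pos.1 hp
    simp only [σ, shear]; field_simp; ring
  let m : {q : ℚ // 0 < q ∧ (q : ℝ) < δ} → Measure ℝ := fun q =>
    (ENNReal.ofReal q.1)⁻¹ • (μ.restrict (D q.1)).map σ
  have hD (q : ℝ) : MeasurableSet (D q) := by
    have h1 : MeasurableSet {p : Plane | 0 < |p 0 - x 0|} :=
      measurableSet_lt (by fun_prop) (by fun_prop)
    have h2 : MeasurableSet {p : Plane | |p 0 - x 0| < q} :=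
      measurableSet_lt (by fun_prop) (by fun_prop)
    exact h1.inter h2
  have hσcone (q t s : ℝ) : σ ⁻¹' ball t s ∩ D q = cone x q t s := by
    ext p
    constructor
    · rintro ⟨h1, h2, h3⟩
      refine ⟨h3, ?_⟩
      rw [hshear t p h2, abs_mul]
      exact mul_lt_mul_of_pos_right h1 h2
    · rintro ⟨h3, h1⟩
      have h2 : 0 < |p 0 - x 0| := by
        rcases (abs_nonneg (p 0 - x 0)).eq_or_lt with h | h
        · rw [← h, mul_zero] at h1
          exact absurd h1 (not_lt.2 (abs_nonneg _))
        · exact h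
      rw [hshear t p h2, abs_mul] at h1
      exact ⟨lt_of_mul_lt_mul_right h1 h2.le, h2, h3⟩
  have hm (q) (t s : ℝ) : m q (ball t s) = (ENNReal.ofReal q.1)⁻¹ * μ (cone x q.1 t s) := by
    simp only [m, Measure.smul_apply, smul_eq_mul]
    rw [Measure.map_apply hσ measurableSet_ball, Measure.restrict_apply (hσ measurableSet_ball),
      hσcone]
  let G : ℕ → Set ℝ := fun k => {t | ¬ LineMeets K δ x t ∧ ∀ s r : ℚ, 0 < s →
    (s : ℝ) < 1 / ((k : ℝ) + 1) → 0 < r → (r : ℝ) < δ →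
      μ (cone x r t s) ≤ ENNReal.ofReal (k * r * s)}
  have hG (k : ℕ) : MeasurableSet (G k) :=
    ((measurable_prodMk_left (x := x)) (measurableSet_lineMeets hK δ).compl).inter
      ((measurable_prodMk_left (x := x)) (measurableSet_cone_bound μ δ k (1 / (k + 1))))
  have hmG (k : ℕ) (q) : m q (G k) = 0 := by
    simp only [m, Measure.smul_apply, smul_eq_mul]
    rw [Measure.map_apply hσ (hG k), Measure.restrict_apply (hσ (hG k))]
    refine mul_eq_zero_of_right _ (measure_mono_null ?_ hμK)
    rintro p ⟨hp, h0, hlt⟩ hpK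
    refine hp.1 ⟨p, hpK, h0, hlt.le.trans q.2.2.le, ?_⟩
    rw [← sub_eq_zero, hshear _ p h0, sub_self, zero_mul]
  have hae := ae_all_iff.2 fun k => ae_measure_ball_le (hG k) (hmG k)
    (c := 2 * (k : ℝ)) (s₀ := 1 / ((k : ℝ) + 1)) (by positivity) (by positivity)
    fun q t ht s hs hs' => by
      obtain ⟨s', h1, h2⟩ := exists_rat_btwn
        (show s < min (2 * s) (1 / ((k : ℝ) + 1)) from lt_min (by linarith) hs')
      have hq : (0 : ℝ) < q.1 := by exact_mod_cast q.2.1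
      have h3 := h2.trans_le (min_le_left _ _)
      rw [hm, mul_comm, ← div_eq_mul_inv]
      refine ENNReal.div_le_of_le_mul ?_
      rw [← ENNReal.ofReal_mul (by positivity)]
      refine (measure_mono (cone_mono le_rfl h1.le)).trans ((ht.2 s' q.1
        (by exact_mod_cast hs.trans h1) (h2.trans_le (min_le_right _ _)) q.2.1 q.2.2).trans
        (ENNReal.ofReal_le_ofReal ?_))
      have : 2 * (k : ℝ) * s * q.1 = k * q.1 * (2 * s) := by ring
      rw [this]
      gcongr
  filter_upwards [hae] with t ht
  by_contra! hcon
  obtain ⟨hmeet, hfat, hthin⟩ := hcon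
  refine hthin fun j => ?_
  unfold FatCones at hfat
  push Not at hfat
  obtain ⟨k, hk⟩ := hfat
  obtain ⟨s₁, hs₁, h⟩ := ht k ⟨hmeet, fun s r h1 h2 h3 h4 => hk s r ⟨h1, h2, h3, h4⟩⟩
    (1 / ((j : ℝ) + 1)) (by positivity)
  obtain ⟨n, hn⟩ := exists_nat_one_div_lt hs₁
  refine ⟨n, fun s r hs hsn hr hrδ => ?_⟩
  have hr' : (0 : ℝ) < r := by exact_mod_cast hr
  have hs' : (0 : ℝ) < s := by exact_mod_cast hs
  have := h s hs' (hsn.trans hn) ⟨r, hr, hrδ⟩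
  rw [hm, mul_comm, ← div_eq_mul_inv, ENNReal.div_le_iff (by simpa using hr')
    ENNReal.ofReal_ne_top, ← ENNReal.ofReal_mul (by positivity)] at this
  exact this.trans_eq (by congr 1; ring)

/-! ### Projections of purely unrectifiable sets -/

theorem ae_volume_shear_image_eq_zero_of_isCompact {K : Set Plane} (hK : IsCompact K)
    (hfin : (μH[1] : Measure Plane) K ≠ ∞) (hpu : CurveNull μH[1] K) :
    ∀ᵐ t, volume (shear t '' K) = 0 := by
  set μ := (μH[1] : Measure Plane).restrict K with hμ
  have : IsFiniteMeasure μ := ⟨by simpa [hμ] using hfin.lt_top⟩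
  have hμK : μ Kᶜ = 0 := by
    rw [hμ, Measure.restrict_apply hK.measurableSet.compl, compl_inter_self, measure_empty]
  have hzero {E : Set Plane} (hEK : E ⊆ K) (hE : μ E = 0) : (μH[1] : Measure Plane) E = 0 := by
    rwa [hμ, Measure.restrict_eq_self _ hEK] at hE
  have htri (j : ℕ) : ∀ᵐ t, ∀ᵐ x ∂μ, LineMeets K (1 / (j + 1)) x t ∨
      FatCones μ (1 / (j + 1)) x t ∨ ThinCones μ (1 / (j + 1)) x t := by
    refine (Measure.ae_ae_comm (μ := μ) (ν := volume) (p := fun x t =>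
      LineMeets K (1 / (j + 1)) x t ∨ FatCones μ (1 / (j + 1)) x t ∨
        ThinCones μ (1 / (j + 1)) x t) ?_).1 (Eventually.of_forall fun x =>
      ae_lineMeets_or_fatCones_or_thinCones hK hμK _ x)
    exact (measurableSet_lineMeets hK _).union
      ((measurableSet_fatCones μ _).union (measurableSet_thinCones μ _))
  filter_upwards [ae_all_iff.2 htri] with t ht
  rw [← ae_all_iff] at ht
  obtain ⟨R, hR⟩ := (hK.image (continuous_shear t)).isBounded.subset_closedBall 0
  have hR' : ∀ x ∈ K, |shear t x| ≤ R := fun x hx => by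
    simpa using hR (mem_image_of_mem _ hx)
  set N := {x ∈ K | ¬ ∀ j : ℕ, LineMeets K (1 / (j + 1)) x t ∨ FatCones μ (1 / (j + 1)) x t ∨
    ThinCones μ (1 / (j + 1)) x t} with hN
  have hN0 : μ N = 0 := measure_mono_null (fun x hx => hx.2) (ae_iff.1 ht)
  have hthin (j : ℕ) : μ {x ∈ K | ThinCones μ (1 / (j + 1)) x t} = 0 := by
    refine measure_eq_zero_of_thinCones (δ := 1 / ((j : ℝ) + 1)) (by positivity)
      (fun x hx => hR' x hx.1) (fun x hx => hx.2) fun f hf => ?_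
    refine le_antisymm ((Measure.restrict_le_self _).trans ?_) zero_le
    exact ((hpu.mono fun x hx => hx.1) f hf).le
  have hcov : shear t '' K ⊆ shear t '' N ∪
      (⋃ j : ℕ, shear t '' {x ∈ K | ThinCones μ (1 / (j + 1)) x t}) ∪
      (⋃ j : ℕ, shear t '' {x | FatCones μ (1 / (j + 1)) x t}) ∪
      {y | {p ∈ K | shear t p = y}.Infinite} := by
    rintro _ ⟨x, hx, rfl⟩
    by_cases hxN : x ∈ N
    · exact Or.inl (Or.inl (Or.inl ⟨x, hxN, rfl⟩))
    have hall : ∀ j : ℕ, LineMeets K (1 / (j + 1)) x t ∨ FatCones μ (1 / (j + 1)) x t ∨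
        ThinCones μ (1 / (j + 1)) x t := not_not.1 fun h => hxN ⟨hx, h⟩
    by_cases hmeet : ∀ j : ℕ, LineMeets K (1 / (j + 1)) x t
    · exact Or.inr (infinite_fibre_of_lineMeets hmeet)
    push Not at hmeet
    obtain ⟨j, hj⟩ := hmeet
    rcases (hall j).resolve_left hj with h | h
    · exact Or.inl (Or.inr (mem_iUnion.2 ⟨j, x, h, rfl⟩))
    · exact Or.inl (Or.inl (Or.inr (mem_iUnion.2 ⟨j, x, ⟨hx, h⟩, rfl⟩)))
  refine measure_mono_null hcov (measure_union_null (measure_union_null (measure_union_null ?_ ?_)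
    ?_) (volume_infinite_fibres hfin t))
  · exact volume_shear_image_eq_zero (hzero (sep_subset _ _) hN0)
  · exact measure_iUnion_null fun j => volume_shear_image_eq_zero (hzero (sep_subset _ _) (hthin j))
  · exact measure_iUnion_null fun j => volume_shear_fatCones

theorem ae_volume_shear_image_eq_zero {A : Set Plane}
    (hA : NullMeasurableSet A (μH[1] : Measure Plane)) (hfin : (μH[1] : Measure Plane) A ≠ ∞)
    (hpu : CurveNull μH[1] A) :
    ∀ᵐ t, volume (shear t '' A) = 0 := by
  obtain ⟨B, hBA, hB, hBae⟩ := hA.exists_measurable_subset_ae_eq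
  set μ := (μH[1] : Measure Plane).restrict B with hμ
  have : IsFiniteMeasure μ := ⟨by simpa [hμ] using (measure_mono hBA).trans_lt hfin.lt_top⟩
  have approx (n : ℕ) : ∃ K ⊆ B, IsCompact K ∧ μ (B \ K) < ((n : ℝ≥0∞) + 1)⁻¹ :=
    hB.exists_isCompact_sdiff_lt (measure_ne_top _ _) (by simp)
  choose K hKB hK hlt using approx
  have hnull : (μH[1] : Measure Plane) (⋂ n, B \ K n) = 0 := by
    have hlim : Tendsto (fun n : ℕ => ((n : ℝ≥0∞) + 1)⁻¹) atTop (𝓝 0) := by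
      have := (tendsto_add_atTop_iff_nat 1).2 ENNReal.tendsto_inv_nat_nhds_zero
      simpa using this
    have h0 : μ (⋂ n, B \ K n) = 0 := le_antisymm (ge_of_tendsto' hlim fun n =>
      (measure_mono (iInter_subset _ n)).trans (hlt n).le) zero_le
    rwa [hμ, Measure.restrict_eq_self _ ((iInter_subset (fun n => B \ K n) 0).trans sdiff_subset)] at h0
  have hAB : (μH[1] : Measure Plane) (A \ B) = 0 := (ae_le_set.1 hBae.symm.le)
  have hKae := ae_all_iff.2 fun n => ae_volume_shear_image_eq_zero_of_isCompact (hK n)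
    ((measure_mono ((hKB n).trans hBA)).trans_lt hfin.lt_top).ne (hpu.mono ((hKB n).trans hBA))
  filter_upwards [hKae] with t ht
  have hcov : shear t '' A ⊆ shear t '' (A \ B) ∪ shear t '' (⋂ n, B \ K n) ∪
      ⋃ n, shear t '' K n := by
    rintro _ ⟨x, hx, rfl⟩
    by_cases hxB : x ∈ B
    · by_cases hxK : ∃ n, x ∈ K n
      · obtain ⟨n, hn⟩ := hxK
        exact Or.inr (mem_iUnion.2 ⟨n, x, hn, rfl⟩)
      · push Not at hxK
        exact Or.inl (Or.inr ⟨x, mem_iInter.2 fun n => ⟨hxB, hxK n⟩, rfl⟩)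
    · exact Or.inl (Or.inl ⟨x, ⟨hx, hxB⟩, rfl⟩)
  exact measure_mono_null hcov (measure_union_null (measure_union_null
    (volume_shear_image_eq_zero hAB) (volume_shear_image_eq_zero hnull)) (measure_iUnion_null ht))

/-! ### The closest-point projections of a normed plane -/

theorem inner_plane (a b : Plane) : ⟪a, b⟫ = a 0 * b 0 + a 1 * b 1 := by
  simp [PiLp.inner_apply, Fin.sum_univ_two, mul_comm]

theorem inner_self_plane_pos {a : Plane} (ha : a ≠ 0) : 0 < a 0 * a 0 + a 1 * a 1 := by
  rw [← inner_plane]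
  exact real_inner_self_pos.2 ha

theorem eq_zero_of_inner_eq_zero {v b c : Plane} (hv : v ≠ 0) (hb : b ≠ 0) (hvb : ⟪v, b⟫ = 0)
    (hvc : ⟪v, c⟫ = 0) (hbc : ⟪b, c⟫ = 0) : c = 0 := by
  have hv' := inner_self_plane_pos hv
  have hb' := inner_self_plane_pos hb
  rw [inner_plane] at hvb hvc hbc
  have hD : v 0 * b 1 - v 1 * b 0 ≠ 0 := fun h => by
    have : (v 0 * v 0 + v 1 * v 1) * (b 0 * b 0 + b 1 * b 1) = 0 := by
      linear_combination (v 0 * b 1 - v 1 * b 0) * h + (v 0 * b 0 + v 1 * b 1) * hvb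
    exact (mul_pos hv' hb').ne' this
  ext i
  fin_cases i
  · exact (mul_eq_zero.1 (show (v 0 * b 1 - v 1 * b 0) * c 0 = 0 by
      linear_combination b 1 * hvc - v 1 * hbc)).resolve_left hD
  · exact (mul_eq_zero.1 (show (v 0 * b 1 - v 1 * b 0) * c 1 = 0 by
      linear_combination v 0 * hbc - b 0 * hvc)).resolve_left hD

/-- Up to a factor, the area form of the plane, as a functional of its second argument. -/
def cross (w : Plane) : Plane →L[ℝ] ℝ := w 0 • EuclideanSpace.proj 1 - w 1 • EuclideanSpace.proj 0

theorem cross_apply (w x : Plane) : cross w x = w 0 * x 1 - w 1 * x 0 := rfl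

/-- The rotation of the plane by a quarter turn. -/
def quarterTurn : Plane →L[ℝ] Plane :=
  (-EuclideanSpace.proj 1 : Plane →L[ℝ] ℝ).smulRight !₂[1, 0] +
    (EuclideanSpace.proj 0 : Plane →L[ℝ] ℝ).smulRight !₂[0, 1]

theorem quarterTurn_apply_zero (x : Plane) : quarterTurn x 0 = -x 1 := by simp [quarterTurn]

theorem quarterTurn_apply_one (x : Plane) : quarterTurn x 1 = x 0 := by simp [quarterTurn]

theorem eq_quarterTurn_or_eq_neg {v u : Plane} (hv : ‖v‖ = 1) (hu : ‖u‖ = 1) (h : ⟪v, u⟫ = 0) :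
    v = quarterTurn u ∨ v = -quarterTurn u := by
  have hv' : v 0 * v 0 + v 1 * v 1 = 1 := by
    rw [← inner_plane, real_inner_self_eq_norm_sq, hv, one_pow]
  have hu' : u 0 * u 0 + u 1 * u 1 = 1 := by
    rw [← inner_plane, real_inner_self_eq_norm_sq, hu, one_pow]
  rw [inner_plane] at h
  set D := v 1 * u 0 - v 0 * u 1 with hD
  have h1 : v 0 = -(D * u 1) := by rw [hD]; linear_combination u 0 * h - v 0 * hu'
  have h2 : v 1 = D * u 0 := by rw [hD]; linear_combination u 1 * h - v 1 * hu'
  have hD2 : D * D = 1 := by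
    rw [h1, h2] at hv'
    linear_combination hv' - D * D * hu'
  rcases mul_self_eq_one_iff.1 hD2 with h3 | h3
  · left
    ext i
    fin_cases i
    · simpa [quarterTurn_apply_zero, h3] using h1
    · simpa [quarterTurn_apply_one, h3] using h2
  · right
    ext i
    fin_cases i
    · simpa [quarterTurn_apply_zero, h3] using h1
    · simpa [quarterTurn_apply_one, h3] using h2

/-- At the point `w`, the linear functional `⟪v, ·⟫` attains its norm dual to `N`. -/
def Norming (N : Plane → ℝ) (v w : Plane) : Prop := ∀ y, |⟪v, y⟫| * N w ≤ |⟪v, w⟫| * N y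

section NormedPlane

variable {N : Plane → ℝ} {γ : ℝ → Plane} {v w z : Plane} {t : ℝ}

theorem Norming.smul (hN_smul : ∀ (c : ℝ) (x : Plane), N (c • x) = |c| * N x)
    (h : Norming N v w) (c : ℝ) : Norming N v (c • w) := fun y => by
  rw [hN_smul, inner_smul_right, abs_mul]
  nlinarith [mul_le_mul_of_nonneg_left (h y) (abs_nonneg c)]

theorem norm_nonneg_of_seminorm (hN_add : ∀ x y : Plane, N (x + y) ≤ N x + N y)
    (hN_smul : ∀ (c : ℝ) (x : Plane), N (c • x) = |c| * N x) (x : Plane) : 0 ≤ N x := by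
  have h0 : N 0 = 0 := by simpa using hN_smul 0 0
  have h1 : N (-x) = N x := by simpa using hN_smul (-1) x
  have h2 := hN_add x (-x)
  rw [add_neg_cancel, h0, h1] at h2
  linarith

theorem Norming.inner_ne_zero (h : Norming N v w) (hv : v ≠ 0) (hw : 0 < N w) : ⟪v, w⟫ ≠ 0 := by
  intro h0
  have := h v
  rw [h0, abs_zero, zero_mul] at this
  have h1 : 0 < |⟪v, v⟫| := abs_pos.2 (inner_self_ne_zero.2 hv)
  exact absurd this (not_le.2 (mul_pos h1 hw))

/-- The tangent to the unit circle at a point where `⟪v, ·⟫` is norming is perpendicular to `v`. -/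
theorem Norming.inner_deriv_eq_zero (hγ : Differentiable ℝ γ) (hγN : ∀ t, N (γ t) = 1)
    (hv : v ≠ 0) (h : Norming N v (γ t)) : ⟪v, deriv γ t⟫ = 0 := by
  have hne := h.inner_ne_zero hv (by rw [hγN]; exact one_pos)
  have hd : HasDerivAt (fun s => ⟪v, γ s⟫) ⟪v, deriv γ t⟫ t := by
    simpa using (hasDerivAt_const t v).inner ℝ (hγ t).hasDerivAt
  have hmax : IsLocalMax (fun s => ⟪v, γ s⟫ ^ 2) t := Eventually.of_forall fun s => by
    have := h (γ s)
    rw [hγN, hγN, mul_one, mul_one] at this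
    exact sq_le_sq.2 this
  have h0 := hmax.hasDerivAt_eq_zero (hd.pow 2)
  simpa [hne] using h0

/-- Strict convexity: the point where `⟪v, ·⟫` is norming is unique. -/
theorem Norming.eq_of_norm_eq_one (hN_add : ∀ x y : Plane, N (x + y) ≤ N x + N y)
    (hN_smul : ∀ (c : ℝ) (x : Plane), N (c • x) = |c| * N x)
    (hγ_C2 : ContDiff ℝ 2 γ) (hγ_range : range γ = {x | N x = 1})
    (hγ_unit : ∀ t, ‖deriv γ t‖ = 1) (hγ_curv : ∀ t, deriv (deriv γ) t ≠ 0) (hv : v ≠ 0)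
    (hw : Norming N v w) (hNw : N w = 1) (hNz : N z = 1)
    (hwz : ⟪v, w⟫ = ⟪v, z⟫) : w = z := by
  by_contra hne
  have hγN (t) : N (γ t) = 1 := by
    have : γ t ∈ range γ := mem_range_self t
    rwa [hγ_range] at this
  have hb : ⟪v, w⟫ ≠ 0 := hw.inner_ne_zero hv (by rw [hNw]; exact one_pos)
  set b := ⟪v, w⟫ with hb_def
  have hconv (l : ℝ) (hl : |l| ≤ 1 / 2) :
      N ((1 / 2 : ℝ) • (w + z) + l • (w - z)) ≤ 1 := by
    have h1 : (1 / 2 : ℝ) • (w + z) + l • (w - z) = (1 / 2 + l) • w + (1 / 2 - l) • z := by module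
    rw [abs_le] at hl
    rw [h1]
    refine (hN_add _ _).trans ?_
    rw [hN_smul, hN_smul, hNw, hNz, abs_of_nonneg (by linarith), abs_of_nonneg (by linarith)]
    linarith
  set m := (1 / 2 : ℝ) • (w + z) with hm
  have hvm : ⟪v, m⟫ = b := by
    rw [hm, inner_smul_right, inner_add_right, ← hwz]; ring
  have hNm : N m = 1 := by
    refine le_antisymm (by simpa using hconv 0 (by norm_num)) ?_
    have := hw m
    rw [hvm, hNw] at this
    exact le_of_mul_le_mul_left this (abs_pos.2 hb)
  obtain ⟨t, ht⟩ : m ∈ range γ := by rw [hγ_range]; exact hNm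
  have hγd : Differentiable ℝ γ := hγ_C2.differentiable (by norm_num)
  have hγ' : Differentiable ℝ (deriv γ) :=
    ((contDiff_succ_iff_deriv (n := 1)).1 hγ_C2).2.2.differentiable (by norm_num)
  set ψ : ℝ → ℝ := fun s => ⟪v, γ s⟫ / b with hψ
  have hψc : Continuous ψ := by have := hγd.continuous; fun_prop
  have hψt : ψ t = 1 := by simp only [hψ]; rw [ht, hvm, div_self hb]
  have hd : w - z ≠ 0 := sub_ne_zero.2 hne
  have hvd : ⟪v, w - z⟫ = 0 := by rw [inner_sub_right, ← hwz, sub_self]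
  set l : ℝ → ℝ := fun s => ⟪w - z, (ψ s)⁻¹ • γ s - m⟫ / ⟪w - z, w - z⟫ with hl
  have hlt : l t = 0 := by simp [hl, hψt, ht]
  have hlc : ContinuousAt l t := by
    have h1 : ContinuousAt (fun s => (ψ s)⁻¹) t := hψc.continuousAt.inv₀ (by simp [hψt])
    have h2 := hγd.continuous.continuousAt (x := t)
    fun_prop
  have hdd : ⟪w - z, w - z⟫ ≠ 0 := inner_self_ne_zero.2 hd
  have hconst : ∀ᶠ s in 𝓝 t, ψ s = 1 := by
    have h1 : ∀ᶠ s in 𝓝 t, 0 < ψ s :=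
      hψc.continuousAt.eventually (lt_mem_nhds (by rw [hψt]; exact one_pos))
    have h2 : ∀ᶠ s in 𝓝 t, |l s| < 1 / 2 :=
      hlc.abs.eventually (gt_mem_nhds (by simp [hlt]))
    filter_upwards [h1, h2] with s hs1 hs2
    have hvs : ⟪v, γ s⟫ = ψ s * b := by simp only [hψ]; field_simp
    have hzero : (ψ s)⁻¹ • γ s - m - l s • (w - z) = 0 := by
      refine eq_zero_of_inner_eq_zero hv hd hvd ?_ ?_
      · rw [inner_sub_right, inner_sub_right, hvm, inner_smul_right, inner_smul_right, hvd, hvs]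
        field_simp
        ring
      · rw [inner_sub_right, inner_smul_right]
        simp only [hl]
        rw [div_mul_cancel₀ _ hdd, sub_self]
    have heq : γ s = ψ s • (m + l s • (w - z)) := by
      rw [sub_sub, sub_eq_zero] at hzero
      rw [← hzero, smul_inv_smul₀ hs1.ne']
    refine le_antisymm ?_ ?_
    · have := hw (γ s)
      rw [hNw, hγN, mul_one, mul_one] at this
      rw [hψ]
      refine (le_abs_self _).trans ?_
      rw [abs_div]
      exact div_le_one_of_le₀ this (abs_nonneg _)
    · have h3 := hγN s
      rw [heq, hN_smul, abs_of_pos hs1] at h3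
      have := mul_le_mul_of_nonneg_left (hconv (l s) hs2.le) hs1.le
      linarith
  have hderiv : (fun s => ⟪v, deriv γ s⟫) =ᶠ[𝓝 t] fun _ => 0 := by
    filter_upwards [hconst.eventually_nhds] with s hs
    have h1 : HasDerivAt ψ (⟪v, deriv γ s⟫ / b) s := by
      simpa using ((hasDerivAt_const s v).inner ℝ (hγd s).hasDerivAt).div_const b
    have h2 := h1.unique ((hasDerivAt_const s (1 : ℝ)).congr_of_eventuallyEq hs)
    exact (div_eq_zero_iff.1 h2).resolve_right hb
  have h2 : ⟪v, deriv (deriv γ) t⟫ = 0 := by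
    have h1 : HasDerivAt (fun s => ⟪v, deriv γ s⟫) ⟪v, deriv (deriv γ) t⟫ t := by
      simpa using (hasDerivAt_const t v).inner ℝ (hγ' t).hasDerivAt
    exact h1.unique ((hasDerivAt_const t (0 : ℝ)).congr_of_eventuallyEq hderiv)
  have h3 : ⟪deriv γ t, deriv (deriv γ) t⟫ = 0 := by
    have h1 := (hγ' t).hasDerivAt.inner ℝ (hγ' t).hasDerivAt
    have h4 : (fun s => ⟪deriv γ s, deriv γ s⟫) = fun _ => (1 : ℝ) := by
      funext s
      rw [real_inner_self_eq_norm_sq, hγ_unit, one_pow]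
    rw [h4] at h1
    have h5 := h1.unique (hasDerivAt_const t (1 : ℝ))
    rw [real_inner_comm (deriv γ t)] at h5
    linarith
  exact hγ_curv t (eq_zero_of_inner_eq_zero hv (norm_ne_zero_iff.1 (by rw [hγ_unit]; simp))
    hderiv.eq_of_nhds h2 h3)

/-- The closest-point projection to the line perpendicular to `v` is linear, and its kernel is spanned by
a point of the unit circle where `⟪v, ·⟫` is norming. -/
theorem exists_norming_projection_eq (hN_add : ∀ x y : Plane, N (x + y) ≤ N x + N y)
    (hN_smul : ∀ (c : ℝ) (x : Plane), N (c • x) = |c| * N x) (hN_zero : ∀ x, N x = 0 → x = 0)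
    (hγ_C2 : ContDiff ℝ 2 γ) (hγ_range : range γ = {x | N x = 1})
    (hγ_unit : ∀ t, ‖deriv γ t‖ = 1) (hγ_curv : ∀ t, deriv (deriv γ) t ≠ 0) (hv : v ≠ 0)
    {p : Plane → Plane} (hp : ∀ x, ⟪v, p x⟫ = 0 ∧ ∀ q, ⟪v, q⟫ = 0 → N (x - p x) ≤ N (x - q)) :
    ∃ t, Norming N v (γ t) ∧ ⟪v, γ t⟫ ≠ 0 ∧ ∀ x, p x = x - (⟪v, x⟫ / ⟪v, γ t⟫) • γ t := by
  have hnn := norm_nonneg_of_seminorm hN_add hN_smul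
  have hN0 : N 0 = 0 := by simpa using hN_smul 0 0
  have hpos {x : Plane} (hx : x ≠ 0) : 0 < N x := (hnn x).lt_of_ne' fun h => hx (hN_zero x h)
  have hinner (x : Plane) : ⟪v, x - p x⟫ = ⟪v, x⟫ := by
    rw [inner_sub_right, (hp x).1, sub_zero]
  have hnorming (x : Plane) : Norming N v (x - p x) := fun y => by
    rcases eq_or_ne ⟪v, y⟫ 0 with h | h
    · rw [h, abs_zero, zero_mul]
      exact mul_nonneg (abs_nonneg _) (hnn y)
    · have h1 := (hp x).2 (x - (⟪v, x⟫ / ⟪v, y⟫) • y) (by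
        rw [inner_sub_right, inner_smul_right, div_mul_cancel₀ _ h, sub_self])
      rw [sub_sub_cancel, hN_smul, abs_div] at h1
      rw [hinner]
      calc |⟪v, y⟫| * N (x - p x) ≤ |⟪v, y⟫| * (|⟪v, x⟫| / |⟪v, y⟫| * N y) := by gcongr
        _ = |⟪v, x⟫| * N y := by
          have := abs_pos.2 h
          field_simp
  have hvv : ⟪v, v⟫ ≠ 0 := inner_self_ne_zero.2 hv
  have hne {x : Plane} (hx : ⟪v, x⟫ ≠ 0) : x - p x ≠ 0 := fun h => by
    have := hinner x
    rw [h, inner_zero_right] at this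
    exact hx this.symm
  have hNv := hpos (hne hvv)
  obtain ⟨t, ht⟩ : (N (v - p v))⁻¹ • (v - p v) ∈ range γ := by
    rw [hγ_range]
    change N _ = 1
    rw [hN_smul, abs_of_pos (inv_pos.2 hNv), inv_mul_cancel₀ hNv.ne']
  have hNγ : N (γ t) = 1 := by
    have : γ t ∈ range γ := mem_range_self t
    rwa [hγ_range] at this
  have hγ : Norming N v (γ t) := by
    rw [ht]
    exact (hnorming v).smul hN_smul _
  have hb := hγ.inner_ne_zero hv (by rw [hNγ]; exact one_pos)
  refine ⟨t, hγ, hb, fun x => ?_⟩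
  rcases eq_or_ne ⟪v, x⟫ 0 with h | h
  · have h1 := (hp x).2 x h
    rw [sub_self, hN0] at h1
    rw [h, zero_div, zero_smul, sub_zero]
    exact (sub_eq_zero.1 (hN_zero _ (h1.antisymm (hnn _)))).symm
  set c := ⟪v, x⟫ / ⟪v, γ t⟫ with hc
  have hc0 : c ≠ 0 := div_ne_zero h hb
  have hNx := hpos (hne h)
  have h1 : N (x - p x) = |c| := by
    have h2 := hnorming x (γ t)
    have h3 := hγ (x - p x)
    rw [hinner, hNγ] at h2 h3
    rw [hc, abs_div, eq_div_iff (abs_pos.2 hb).ne']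
    linarith
  have h2 : c⁻¹ • (x - p x) = γ t := by
    refine Norming.eq_of_norm_eq_one hN_add hN_smul hγ_C2 hγ_range hγ_unit hγ_curv hv
      ((hnorming x).smul hN_smul _) ?_ hNγ ?_
    · rw [hN_smul, h1, ← abs_mul, inv_mul_cancel₀ hc0, abs_one]
    · rw [inner_smul_right, hinner, hc]
      field_simp
  rw [← h2, smul_inv_smul₀ hc0, sub_sub_cancel]

end NormedPlane

/-! ### Exceptional directions -/

theorem volume_setOf_slope_mem_eq_zero {γ : ℝ → Plane} (hγ : Differentiable ℝ γ) {Z : Set ℝ}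
    (hZ : volume Z = 0) :
    volume {t | cross (γ t) (deriv γ t) ≠ 0 ∧ (γ t 0 ≠ 0 → γ t 1 / γ t 0 ∈ Z)} = 0 := by
  have hd (i : Fin 2) (t : ℝ) : HasDerivAt (fun s => γ s i) (deriv γ t i) t :=
    (EuclideanSpace.proj (𝕜 := ℝ) i).hasFDerivAt.comp_hasDerivAt t (hγ t).hasDerivAt
  have h1 : volume {t ∈ {t | γ t 0 = 0} | deriv γ t 0 ≠ 0} = 0 :=
    volume_deriv_ne_zero_eq_zero_of_image (f := fun t => γ t 0) (fun t _ => hd 0 t)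
      (measure_mono_null (t := {0}) (image_subset_iff.2 fun t ht => ht) (measure_singleton (0 : ℝ)))
  have h2 : volume {t ∈ {t | γ t 0 ≠ 0 ∧ γ t 1 / γ t 0 ∈ Z} |
      (deriv γ t 1 * γ t 0 - γ t 1 * deriv γ t 0) / γ t 0 ^ 2 ≠ 0} = 0 :=
    volume_deriv_ne_zero_eq_zero_of_image (f := fun t => γ t 1 / γ t 0)
      (fun t ht => (hd 1 t).div (hd 0 t) ht.1)
      (measure_mono_null (image_subset_iff.2 fun t ht => ht.2) hZ)
  refine measure_mono_null (fun t ht => ?_) (measure_union_null h1 h2)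
  obtain ⟨hc, ht⟩ := ht
  rw [cross_apply] at hc
  by_cases h0 : γ t 0 = 0
  · refine Or.inl ⟨h0, fun h => hc ?_⟩
    rw [h0, h]; ring
  · refine Or.inr ⟨⟨h0, ht h0⟩, div_ne_zero (fun h => hc ?_) (pow_ne_zero 2 h0)⟩
    linear_combination h

theorem hausdorffMeasure_image_eq_zero_of_contDiff {f : ℝ → Plane} (hf : ContDiff ℝ 1 f)
    {T : Set ℝ} (hT : volume T = 0) : (μH[1] : Measure Plane) (f '' T) = 0 := by
  have hcov : f '' T ⊆ ⋃ n : ℕ, f '' (T ∩ Icc (-(n : ℝ)) n) := by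
    rintro _ ⟨t, ht, rfl⟩
    obtain ⟨n, hn⟩ := exists_nat_ge |t|
    exact mem_iUnion.2 ⟨n, t, ⟨ht, abs_le.1 hn⟩, rfl⟩
  refine measure_mono_null hcov (measure_iUnion_null fun n => ?_)
  obtain ⟨C, hC⟩ := hf.locallyLipschitz.locallyLipschitzOn.exists_lipschitzOnWith_of_compact
    (isCompact_Icc (a := -(n : ℝ)) (b := n))
  have := (hC.mono inter_subset_right).hausdorffMeasure_image_le (d := 1) zero_le_one (s := T ∩ _)
  rw [hausdorffMeasure_real, measure_mono_null inter_subset_left hT, mul_zero] at this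
  exact le_antisymm this zero_le

theorem hausdorffMeasure_projection_image_eq_zero {A : Set Plane} {p : Plane → Plane} {v w : Plane}
    (hvw : ⟪v, w⟫ ≠ 0) (hp : ∀ x, p x = x - (⟪v, x⟫ / ⟪v, w⟫) • w) (hw : w 0 ≠ 0)
    (hA : volume (shear (w 1 / w 0) '' A) = 0) : (μH[1] : Measure Plane) (p '' A) = 0 := by
  set b := p !₂[0, 1]
  have hsub : p '' A ⊆ ContinuousLinearMap.toSpanSingleton ℝ b '' (shear (w 1 / w 0) '' A) := by
    rintro _ ⟨x, hx, rfl⟩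
    refine ⟨_, ⟨x, hx, rfl⟩, ?_⟩
    rw [ContinuousLinearMap.toSpanSingleton_apply, hp x]
    simp only [b, hp, shear, inner_plane] at hvw ⊢
    have hvw' : w 0 * v 0 + w 1 * v 1 ≠ 0 := by rwa [mul_comm (w 0), mul_comm (w 1)]
    ext i
    fin_cases i <;> simp <;> field_simp <;> ring
  refine measure_mono_null hsub (le_antisymm ?_ zero_le)
  have := (ContinuousLinearMap.toSpanSingleton ℝ b).lipschitz.hausdorffMeasure_image_le (d := 1)
    zero_le_one (shear (w 1 / w 0) '' A)
  rwa [hausdorffMeasure_real, hA, mul_zero] at this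

theorem volume_cross_image_eq_zero {A : Set Plane} {p : Plane → Plane} {v w : Plane}
    (hp : ∀ x, p x = x - (⟪v, x⟫ / ⟪v, w⟫) • w) (hA : (μH[1] : Measure Plane) (p '' A) = 0) :
    volume (cross w '' A) = 0 := by
  have hsub : cross w '' A ⊆ cross w '' (p '' A) := by
    rintro _ ⟨x, hx, rfl⟩
    refine ⟨p x, mem_image_of_mem _ hx, ?_⟩
    rw [hp, map_sub, map_smul, cross_apply w w]
    simp [mul_comm]
  refine measure_mono_null hsub (le_antisymm ?_ zero_le)
  have := (cross w).lipschitz.hausdorffMeasure_image_le (d := 1) zero_le_one (p '' A)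
  rwa [hausdorffMeasure_real, hA, mul_zero] at this

/-- A set with null projections in two directions meets every Lipschitz curve in a null set. -/
theorem curveNull_of_cross {A : Set Plane} {w z : Plane} (hwz : cross w z ≠ 0)
    (hw : volume (cross w '' A) = 0) (hz : volume (cross z '' A) = 0) : CurveNull μH[1] A := by
  rintro f ⟨C, hf⟩
  set B := {u | f u ∈ A ∧ DifferentiableAt ℝ f u}
  have hB (y : Plane) (hy : volume (cross y '' A) = 0) :
      volume {u ∈ B | cross y (deriv f u) ≠ 0} = 0 := by
    refine volume_deriv_ne_zero_eq_zero_of_image (f := fun u => cross y (f u))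
      (fun u hu => (cross y).hasFDerivAt.comp_hasDerivAt u hu.2.hasDerivAt)
      (measure_mono_null ?_ hy)
    rintro _ ⟨u, hu, rfl⟩
    exact mem_image_of_mem _ hu.1
  have hnull {T : Set ℝ} (hT : volume T = 0) : (μH[1] : Measure Plane) (f '' T) = 0 := by
    have := hf.hausdorffMeasure_image_le (d := 1) zero_le_one T
    rw [hausdorffMeasure_real, hT, mul_zero] at this
    exact le_antisymm this zero_le
  have hzero : (μH[1] : Measure Plane) (f '' {u ∈ B | deriv f u = 0}) = 0 :=
    hausdorffMeasure_image_eq_zero_of_hasDerivAt_zero fun u hu => hu.2 ▸ hu.1.2.hasDerivAt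
  refine measure_mono_null ?_ (measure_union_null (measure_union_null
    (hnull (ae_iff.1 hf.ae_differentiableAt)) hzero)
    (measure_union_null (hnull (hB w hw)) (hnull (hB z hz))))
  rintro _ ⟨hA, u, rfl⟩
  by_cases hu : DifferentiableAt ℝ f u
  swap
  · exact Or.inl (Or.inl ⟨u, hu, rfl⟩)
  by_cases h1 : cross w (deriv f u) = 0
  swap
  · exact Or.inr (Or.inl ⟨u, ⟨⟨hA, hu⟩, h1⟩, rfl⟩)
  by_cases h2 : cross z (deriv f u) = 0
  swap
  · exact Or.inr (Or.inr ⟨u, ⟨⟨hA, hu⟩, h2⟩, rfl⟩)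
  refine Or.inl (Or.inr ⟨u, ⟨⟨hA, hu⟩, ?_⟩, rfl⟩)
  rw [cross_apply] at h1 h2 hwz
  ext i
  fin_cases i
  · exact (mul_eq_zero.1 (show (w 0 * z 1 - w 1 * z 0) * deriv f u 0 = 0 by
      linear_combination z 0 * h1 - w 0 * h2)).resolve_left hwz
  · exact (mul_eq_zero.1 (show (w 0 * z 1 - w 1 * z 0) * deriv f u 1 = 0 by
      linear_combination z 1 * h1 - w 1 * h2)).resolve_left hwz

theorem hausdorffMeasure_sphere_ne_zero : (μH[1] : Measure Plane) (sphere 0 1) ≠ 0 := fun h => by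
  have hsub : Icc (-1 : ℝ) 1 ⊆ EuclideanSpace.proj (𝕜 := ℝ) (0 : Fin 2) '' sphere (0 : Plane) 1 := by
    intro a ha
    refine ⟨!₂[a, √(1 - a ^ 2)], ?_, by simp⟩
    have : 0 ≤ 1 - a ^ 2 := by nlinarith [ha.1, ha.2]
    simp [EuclideanSpace.norm_eq, Real.sq_sqrt this]
  have h1 := (EuclideanSpace.proj (𝕜 := ℝ) (0 : Fin 2)).lipschitz.hausdorffMeasure_image_le (d := 1)
    zero_le_one (sphere (0 : Plane) 1)
  rw [h, mul_zero, hausdorffMeasure_real] at h1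
  have h2 := (measure_mono hsub).trans h1
  rw [Real.volume_Icc] at h2
  norm_num at h2

theorem exists_pair_of_ae_sphere {p : Plane → Prop}
    (h : ∀ᵐ v ∂(μH[1] : Measure Plane).restrict (sphere 0 1), p v) :
    ∃ v ∈ sphere (0 : Plane) 1, ∃ u ∈ sphere (0 : Plane) 1, p v ∧ p u ∧ u ≠ v ∧ u ≠ -v := by
  have : NullSingletonClass (μH[1] : Measure Plane) := Measure.nullSingletonClass_hausdorff _ one_pos
  have : NeBot (ae ((μH[1] : Measure Plane).restrict (sphere 0 1))) :=
    ae_neBot.2 fun h => hausdorffMeasure_sphere_ne_zero (Measure.restrict_eq_zero.1 h)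
  have h' := h.and (ae_restrict_mem isClosed_sphere.measurableSet)
  obtain ⟨v, hv, hvS⟩ := h'.exists
  have hne (y : Plane) : ∀ᵐ u ∂(μH[1] : Measure Plane).restrict (sphere 0 1), u ≠ y :=
    ae_restrict_of_ae (compl_mem_ae_iff.2 (measure_singleton y))
  obtain ⟨u, ⟨hu, huS⟩, h1, h2⟩ := (h'.and ((hne v).and (hne (-v)))).exists
  exact ⟨v, hvS, u, huS, hv, hu, h1, h2⟩

section NormedPlane

variable {N : Plane → ℝ} {γ : ℝ → Plane} {P : Plane → Plane → Plane} {A : Set Plane}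

theorem cross_ne_zero_of_norming (hN_smul : ∀ (c : ℝ) (x : Plane), N (c • x) = |c| * N x)
    (hγ : Differentiable ℝ γ) (hγN : ∀ t, N (γ t) = 1) (hγ_unit : ∀ t, ‖deriv γ t‖ = 1)
    {v u : Plane} (hv : ‖v‖ = 1) (hu : ‖u‖ = 1) (huv : u ≠ v) (huv' : u ≠ -v) {t s : ℝ}
    (ht : Norming N v (γ t)) (hs : Norming N u (γ s)) : cross (γ t) (γ s) ≠ 0 := by
  intro h0
  have hv0 : v ≠ 0 := norm_ne_zero_iff.1 (by rw [hv]; simp)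
  have hu0 : u ≠ 0 := norm_ne_zero_iff.1 (by rw [hu]; simp)
  have hvt := ht.inner_ne_zero hv0 (by rw [hγN]; exact one_pos)
  have hN0 : N 0 = 0 := by simpa using hN_smul 0 0
  have hne (t : ℝ) : γ t ≠ 0 := fun h => by
    have := hγN t
    rw [h, hN0] at this
    exact zero_ne_one this
  have hpos := inner_self_plane_pos (hne s)
  have hpar : γ t = ((γ s 0 * γ t 0 + γ s 1 * γ t 1) / (γ s 0 * γ s 0 + γ s 1 * γ s 1)) • γ s := by
    rw [cross_apply] at h0
    ext i
    fin_cases i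
    · simp only [Fin.zero_eta, PiLp.smul_apply, smul_eq_mul]
      rw [div_mul_eq_mul_div, eq_div_iff hpos.ne']
      linear_combination γ s 1 * h0
    · simp only [Fin.mk_one, PiLp.smul_apply, smul_eq_mul]
      rw [div_mul_eq_mul_div, eq_div_iff hpos.ne']
      linear_combination -γ s 0 * h0
  have hs' : Norming N u (γ t) := by
    rw [hpar]
    exact hs.smul hN_smul _
  have h1 := ht.inner_deriv_eq_zero hγ hγN hv0
  have h2 := hs'.inner_deriv_eq_zero hγ hγN hu0
  rcases eq_quarterTurn_or_eq_neg hv (hγ_unit t) h1 with h3 | h3 <;>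
    rcases eq_quarterTurn_or_eq_neg hu (hγ_unit t) h2 with h4 | h4 <;>
    simp_all

theorem ae_hausdorffMeasure_projection_image_eq_zero (hγ_C2 : ContDiff ℝ 2 γ)
    (hγN : ∀ t, N (γ t) = 1) (hγ_unit : ∀ t, ‖deriv γ t‖ = 1)
    (hP : ∀ v ∈ sphere (0 : Plane) 1, ∃ t, Norming N v (γ t) ∧ ⟪v, γ t⟫ ≠ 0 ∧
      ∀ x, P v x = x - (⟪v, x⟫ / ⟪v, γ t⟫) • γ t)
    (hA : ∀ᵐ t, volume (shear t '' A) = 0) :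
    ∀ᵐ v ∂(μH[1] : Measure Plane).restrict (sphere 0 1), (μH[1] : Measure Plane) (P v '' A) = 0 := by
  have hγ : Differentiable ℝ γ := hγ_C2.differentiable (by norm_num)
  have hγ' : ContDiff ℝ 1 (deriv γ) := ((contDiff_succ_iff_deriv (n := 1)).1 hγ_C2).2.2
  rw [ae_restrict_iff' isClosed_sphere.measurableSet, ae_iff]
  have hT := volume_setOf_slope_mem_eq_zero hγ (ae_iff.1 hA)
  refine measure_mono_null ?_ (measure_union_null
    (hausdorffMeasure_image_eq_zero_of_contDiff (quarterTurn.contDiff.comp hγ') hT)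
    (hausdorffMeasure_image_eq_zero_of_contDiff (quarterTurn.contDiff.comp hγ').neg hT))
  intro v hv
  rw [mem_ofPred_eq, Classical.not_imp] at hv
  obtain ⟨hvS, hv⟩ := hv
  have hv1 : ‖v‖ = 1 := mem_sphere_zero_iff_norm.1 hvS
  obtain ⟨t, ht, hvt, hPv⟩ := hP v hvS
  have hperp := ht.inner_deriv_eq_zero hγ hγN (norm_ne_zero_iff.1 (by rw [hv1]; simp))
  have hcases := eq_quarterTurn_or_eq_neg hv1 (hγ_unit t) hperp
  have htT : cross (γ t) (deriv γ t) ≠ 0 ∧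
      (γ t 0 ≠ 0 → γ t 1 / γ t 0 ∈ {t | ¬ volume (shear t '' A) = 0}) := by
    refine ⟨fun h => hvt ?_, fun h0 h => hv ?_⟩
    · rw [cross_apply] at h
      rcases hcases with h' | h' <;> rw [h', inner_plane] <;>
        simp only [PiLp.neg_apply, quarterTurn_apply_zero, quarterTurn_apply_one]
      · linear_combination -h
      · linear_combination h
    · exact hausdorffMeasure_projection_image_eq_zero hvt hPv h0 h
  rcases hcases with h | h
  · exact Or.inl ⟨t, htT, h.symm⟩
  · exact Or.inr ⟨t, htT, h.symm⟩

theorem curveNull_of_ae_projection (hN_smul : ∀ (c : ℝ) (x : Plane), N (c • x) = |c| * N x)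
    (hγ : Differentiable ℝ γ) (hγN : ∀ t, N (γ t) = 1) (hγ_unit : ∀ t, ‖deriv γ t‖ = 1)
    (hP : ∀ v ∈ sphere (0 : Plane) 1, ∃ t, Norming N v (γ t) ∧ ⟪v, γ t⟫ ≠ 0 ∧
      ∀ x, P v x = x - (⟪v, x⟫ / ⟪v, γ t⟫) • γ t)
    (hA : ∀ᵐ v ∂(μH[1] : Measure Plane).restrict (sphere 0 1),
      (μH[1] : Measure Plane) (P v '' A) = 0) : CurveNull μH[1] A := by
  obtain ⟨v, hvS, u, huS, hv, hu, h1, h2⟩ := exists_pair_of_ae_sphere hA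
  obtain ⟨t, ht, -, hPv⟩ := hP v hvS
  obtain ⟨s, hs, -, hPu⟩ := hP u huS
  exact curveNull_of_cross (cross_ne_zero_of_norming hN_smul hγ hγN hγ_unit
    (mem_sphere_zero_iff_norm.1 hvS) (mem_sphere_zero_iff_norm.1 huS) h1 h2 ht hs)
    (volume_cross_image_eq_zero hPv hv) (volume_cross_image_eq_zero hPu hu)

end NormedPlane

end BesicovitchFederer

/-- Besicovitch–Federer type characterization: an ℋ¹-measurable set
`A` with `ℋ¹(A) < ∞` is purely 1-unrectifiable iff `ℋ¹(P_v(A)) = 0` for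
ℋ¹-a.e. `v ∈ S¹`. -/
theorem besicovitch_federer_normed_plane
    (N : EuclideanSpace ℝ (Fin 2) → ℝ)
    (hN_add : ∀ x y : EuclideanSpace ℝ (Fin 2), N (x + y) ≤ N x + N y)
    (hN_smul : ∀ (c : ℝ) (x : EuclideanSpace ℝ (Fin 2)), N (c • x) = |c| * N x)
    (hN_zero : ∀ x : EuclideanSpace ℝ (Fin 2), N x = 0 → x = 0)
    -- `N` restricted to `ℝ² \ {0}` is of class `C^{2,δ}` for some `δ ∈ (0,1)`:
    (δ : ℝ) (hδ0 : 0 < δ) (hδ1 : δ < 1)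
    (hN_C2 : ContDiffOn ℝ 2 N ({0}ᶜ : Set (EuclideanSpace ℝ (Fin 2))))
    (hN_holder : ∀ K : Set (EuclideanSpace ℝ (Fin 2)), K ⊆ {0}ᶜ → IsCompact K →
      ∃ M : ℝ, ∀ x ∈ K, ∀ y ∈ K,
        ‖iteratedFDerivWithin ℝ 2 N ({0}ᶜ : Set (EuclideanSpace ℝ (Fin 2))) x -
          iteratedFDerivWithin ℝ 2 N ({0}ᶜ : Set (EuclideanSpace ℝ (Fin 2))) y‖ ≤
            M * ‖x - y‖ ^ δ)
    -- the N-unit circle has an arc-length parametrization with everywhere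
    -- nonvanishing second derivative (strictly positive curvature):
    (γ : ℝ → EuclideanSpace ℝ (Fin 2)) (L : ℝ) (hL : 0 < L)
    (hγ_C2 : ContDiff ℝ 2 γ)
    (hγ_per : ∀ t, γ (t + L) = γ t)
    (hγ_range : Set.range γ = {x : EuclideanSpace ℝ (Fin 2) | N x = 1})
    (hγ_unit : ∀ t, ‖deriv γ t‖ = 1)
    (hγ_curv : ∀ t, deriv (deriv γ) t ≠ 0)
    -- `P v` is the closest-point projection (w.r.t. `N`) onto the line `H_v`:
    (P : EuclideanSpace ℝ (Fin 2) → EuclideanSpace ℝ (Fin 2) → EuclideanSpace ℝ (Fin 2))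
    (hP : ∀ v ∈ sphere (0 : EuclideanSpace ℝ (Fin 2)) 1, ∀ x : EuclideanSpace ℝ (Fin 2),
      ⟪v, P v x⟫ = 0 ∧
        ∀ q : EuclideanSpace ℝ (Fin 2), ⟪v, q⟫ = 0 → N (x - P v x) ≤ N (x - q))
    (A : Set (EuclideanSpace ℝ (Fin 2)))
    (hA : NullMeasurableSet A (μH[1] : Measure (EuclideanSpace ℝ (Fin 2))))
    (hAfin : (μH[1] : Measure (EuclideanSpace ℝ (Fin 2))) A < ⊤) :
    (∀ f : ℝ → EuclideanSpace ℝ (Fin 2), (∃ c : NNReal, LipschitzWith c f) →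
        (μH[1] : Measure (EuclideanSpace ℝ (Fin 2))) (A ∩ Set.range f) = 0) ↔
      ∀ᵐ v ∂((μH[1] : Measure (EuclideanSpace ℝ (Fin 2))).restrict
          (sphere (0 : EuclideanSpace ℝ (Fin 2)) 1)),
        (μH[1] : Measure (EuclideanSpace ℝ (Fin 2))) (P v '' A) = 0 := by
  have hγN (t : ℝ) : N (γ t) = 1 := by
    have : γ t ∈ range γ := mem_range_self t
    rwa [hγ_range] at this
  have hproj : ∀ v ∈ sphere (0 : EuclideanSpace ℝ (Fin 2)) 1,
      ∃ t, BesicovitchFederer.Norming N v (γ t) ∧ ⟪v, γ t⟫ ≠ 0 ∧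
        ∀ x, P v x = x - (⟪v, x⟫ / ⟪v, γ t⟫) • γ t := fun v hv =>
    BesicovitchFederer.exists_norming_projection_eq hN_add hN_smul hN_zero hγ_C2 hγ_range hγ_unit
      hγ_curv (ne_zero_of_mem_unit_sphere ⟨v, hv⟩) (hP v hv)
  exact ⟨fun hpu => BesicovitchFederer.ae_hausdorffMeasure_projection_image_eq_zero hγ_C2 hγN
      hγ_unit hproj (BesicovitchFederer.ae_volume_shear_image_eq_zero hA hAfin.ne hpu),
    BesicovitchFederer.curveNull_of_ae_projection hN_smul
      (hγ_C2.differentiable (by norm_num)) hγN hγ_unit hproj⟩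
end
end

section
/- Let N be a norm on ℝ² whose restriction to ℝ² \ {0} is of class C², and let γ : ℝ → ∂B_N(0,1) be the periodic counterclockwise arc-length C²-parametrization of the N-unit circle. Then the Gauss map G : ∂B_N(0,1) → S¹ is a C¹-diffeomorphism if and only if γ''(t) ≠ 0 for every t ∈ ℝ (i.e., the curvature K(γ(t)) = ‖γ''(t)‖ is everywhere nonzero); moreover, in this case B_N(0,1) is strictly convex. -/
open Set Metric
open scoped RealInnerProductSpace

noncomputable section

/-- A norm on the Euclidean plane which is of class `C²` away from the origin. -/
structure IsC2Norm (N : EuclideanSpace ℝ (Fin 2) → ℝ) : Prop where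
  add_le : ∀ x y, N (x + y) ≤ N x + N y
  smul : ∀ (c : ℝ) x, N (c • x) = |c| * N x
  eq_zero : ∀ x, N x = 0 → x = 0
  contDiffOn : ContDiffOn ℝ 2 N {0}ᶜ

/-- The normalized gradient of `N`. -/
def normalizedGradient (N : EuclideanSpace ℝ (Fin 2) → ℝ) (x : EuclideanSpace ℝ (Fin 2)) :
    EuclideanSpace ℝ (Fin 2) :=
  ‖gradient N x‖⁻¹ • gradient N x

theorem eq_zero_of_inner_eq_zero_of_inner_eq_zero {a b v : EuclideanSpace ℝ (Fin 2)}
    (ha : a ≠ 0) (hb : b ≠ 0) (hab : ⟪a, b⟫ = 0) (hva : ⟪v, a⟫ = 0) (hvb : ⟪v, b⟫ = 0) :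
    v = 0 := by
  have ha' : 0 < ⟪a, a⟫ := real_inner_self_pos.2 ha
  have hb' : 0 < ⟪b, b⟫ := real_inner_self_pos.2 hb
  simp only [PiLp.inner_apply, Fin.sum_univ_two, RCLike.inner_apply, conj_trivial]
    at ha' hb' hab hva hvb
  have hdet : a 0 * b 1 - a 1 * b 0 ≠ 0 := by
    intro h
    have h1 := mul_pos ha' hb'
    have h2 : (a 0 * a 0 + a 1 * a 1) * (b 0 * b 0 + b 1 * b 1)
      = (a 0 * b 1 - a 1 * b 0) ^ 2 + (b 0 * a 0 + b 1 * a 1) ^ 2 := by ring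
    rw [h2, h, hab] at h1
    simp at h1
  ext i
  fin_cases i
  · refine (mul_eq_zero.1 (?_ : v 0 * (a 0 * b 1 - a 1 * b 0) = 0)).resolve_right hdet
    linear_combination b 1 * hva - a 1 * hvb
  · refine (mul_eq_zero.1 (?_ : v 1 * (a 0 * b 1 - a 1 * b 0) = 0)).resolve_right hdet
    linear_combination a 0 * hvb - b 0 * hva

theorem inner_ne_zero_of_inner_eq_zero {a v b : EuclideanSpace ℝ (Fin 2)} (ha : a ≠ 0)
    (hb : b ≠ 0) (hv : v ≠ 0) (hab : ⟪a, b⟫ = 0) (hva : ⟪v, a⟫ = 0) : ⟪v, b⟫ ≠ 0 :=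
  fun h ↦ hv (eq_zero_of_inner_eq_zero_of_inner_eq_zero ha hb hab hva h)

theorem eq_inner_smul_of_inner_eq_zero {a b v : EuclideanSpace ℝ (Fin 2)}
    (ha : a ≠ 0) (hb : ‖b‖ = 1) (hab : ⟪a, b⟫ = 0) (hva : ⟪v, a⟫ = 0) : v = ⟪v, b⟫ • b := by
  have hb0 : b ≠ 0 := by rintro rfl; simp at hb
  refine sub_eq_zero.1 (eq_zero_of_inner_eq_zero_of_inner_eq_zero ha hb0 hab ?_ ?_)
  · rw [inner_sub_left, real_inner_smul_left, real_inner_comm a b, hab, hva]; simp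
  · rw [inner_sub_left, real_inner_smul_left, real_inner_self_eq_norm_sq, hb]; simp

namespace IsC2Norm

variable {N : EuclideanSpace ℝ (Fin 2) → ℝ}

theorem ne_zero (hN : IsC2Norm N) {x : EuclideanSpace ℝ (Fin 2)} (hx : N x = 1) : x ≠ 0 := by
  rintro rfl
  have := hN.smul 0 0
  simp [hx] at this

theorem nonneg (hN : IsC2Norm N) (x : EuclideanSpace ℝ (Fin 2)) : 0 ≤ N x := by
  have h0 := hN.smul 0 0
  have h1 := hN.smul (-1) x
  have h2 := hN.add_le x ((-1 : ℝ) • x)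
  simp at h0 h1 h2
  linarith

theorem pos (hN : IsC2Norm N) {x : EuclideanSpace ℝ (Fin 2)} (hx : x ≠ 0) : 0 < N x :=
  (hN.nonneg x).lt_of_ne fun h ↦ hx (hN.eq_zero x h.symm)

theorem contDiffAt (hN : IsC2Norm N) {x : EuclideanSpace ℝ (Fin 2)} (hx : x ≠ 0) :
    ContDiffAt ℝ 2 N x :=
  hN.contDiffOn.contDiffAt (isOpen_compl_singleton.mem_nhds hx)

theorem hasGradientAt (hN : IsC2Norm N) {x : EuclideanSpace ℝ (Fin 2)} (hx : x ≠ 0) :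
    HasGradientAt N (gradient N x) x :=
  ((hN.contDiffAt hx).differentiableAt (by norm_num)).hasGradientAt

theorem contDiffAt_gradient (hN : IsC2Norm N) {x : EuclideanSpace ℝ (Fin 2)} (hx : x ≠ 0) :
    ContDiffAt ℝ 1 (gradient N) x := by
  have h : ContDiffAt ℝ 1 (fderiv ℝ N) x := (hN.contDiffAt hx).fderiv_right (by norm_num)
  exact (InnerProductSpace.toDual ℝ _).symm.contDiff.contDiffAt.comp x h

theorem hasDerivAt_comp_line (hN : IsC2Norm N) {x : EuclideanSpace ℝ (Fin 2)} (hx : x ≠ 0)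
    (y : EuclideanSpace ℝ (Fin 2)) :
    HasDerivAt (fun s : ℝ ↦ N (x + s • y)) ⟪gradient N x, y⟫ 0 := by
  have h1 : HasDerivAt (fun s : ℝ ↦ x + s • y) y 0 := by
    simpa using ((hasDerivAt_id (0 : ℝ)).smul_const y).const_add x
  have h2 := (hN.hasGradientAt hx).hasFDerivAt
  have h3 : HasFDerivAt N (InnerProductSpace.toDual ℝ _ (gradient N x)) (x + (0 : ℝ) • y) := by
    simpa using h2
  exact h3.comp_hasDerivAt (0 : ℝ) h1

theorem inner_gradient_le (hN : IsC2Norm N) {x : EuclideanSpace ℝ (Fin 2)} (hx : x ≠ 0)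
    (y : EuclideanSpace ℝ (Fin 2)) : ⟪gradient N x, y⟫ ≤ N y := by
  have h := (hN.hasDerivAt_comp_line hx y).tendsto_slope_zero_right
  refine le_of_tendsto h (eventually_mem_nhdsWithin.mono fun s hs ↦ ?_)
  have hs : 0 < s := hs
  have h1 := hN.add_le x (s • y)
  rw [hN.smul, abs_of_pos hs] at h1
  simp only [zero_add, zero_smul, add_zero, smul_eq_mul]
  rw [inv_mul_le_iff₀ hs]
  linarith

theorem inner_gradient_self (hN : IsC2Norm N) {x : EuclideanSpace ℝ (Fin 2)} (hx : x ≠ 0) :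
    ⟪gradient N x, x⟫ = N x := by
  refine (hN.hasDerivAt_comp_line hx x).unique ?_
  have h : HasDerivAt (fun s : ℝ ↦ (1 + s) * N x) (N x) 0 := by
    simpa using ((hasDerivAt_id (0 : ℝ)).const_add 1).mul_const (N x)
  refine h.congr_of_eventuallyEq ?_
  filter_upwards [lt_mem_nhds (show (-1 : ℝ) < 0 by norm_num)] with s hs
  rw [show x + s • x = (1 + s) • x by rw [add_smul, one_smul], hN.smul, abs_of_pos (by linarith)]

theorem gradient_ne_zero (hN : IsC2Norm N) {x : EuclideanSpace ℝ (Fin 2)} (hx : x ≠ 0) :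
    gradient N x ≠ 0 := fun h ↦ by
  have h1 := hN.inner_gradient_self hx
  rw [h, inner_zero_left] at h1
  exact (hN.pos hx).ne h1

theorem norm_normalizedGradient (hN : IsC2Norm N) {x : EuclideanSpace ℝ (Fin 2)} (hx : x ≠ 0) :
    ‖normalizedGradient N x‖ = 1 := by
  have := norm_ne_zero_iff.2 (hN.gradient_ne_zero hx)
  rw [normalizedGradient, norm_smul, norm_inv, norm_norm, inv_mul_cancel₀ this]

theorem norm_smul_normalizedGradient (hN : IsC2Norm N) {x : EuclideanSpace ℝ (Fin 2)}
    (hx : x ≠ 0) : ‖gradient N x‖ • normalizedGradient N x = gradient N x := by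
  have := norm_ne_zero_iff.2 (hN.gradient_ne_zero hx)
  rw [normalizedGradient, smul_smul, mul_inv_cancel₀ this, one_smul]

theorem contDiffAt_normalizedGradient (hN : IsC2Norm N) {x : EuclideanSpace ℝ (Fin 2)}
    (hx : x ≠ 0) : ContDiffAt ℝ 1 (normalizedGradient N) x :=
  have h := hN.contDiffAt_gradient hx
  have h0 := hN.gradient_ne_zero hx
  ((h.norm ℝ h0).inv (norm_ne_zero_iff.2 h0)).smul h

theorem inner_normalizedGradient_fderiv (hN : IsC2Norm N) {x : EuclideanSpace ℝ (Fin 2)}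
    (hx : x ≠ 0) (v : EuclideanSpace ℝ (Fin 2)) :
    ⟪normalizedGradient N x, fderiv ℝ (normalizedGradient N) x v⟫ = 0 := by
  have hd := ((hN.contDiffAt_normalizedGradient hx).differentiableAt one_ne_zero).hasFDerivAt
  have h1 := hd.norm_sq
  have h2 : HasFDerivAt (fun y ↦ ‖normalizedGradient N y‖ ^ 2)
      (0 : EuclideanSpace ℝ (Fin 2) →L[ℝ] ℝ) x := by
    refine (hasFDerivAt_const (1 : ℝ) x).congr_of_eventuallyEq ?_
    filter_upwards [isOpen_compl_singleton.mem_nhds hx] with y hy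
    rw [hN.norm_normalizedGradient hy, one_pow]
  have h3 := DFunLike.congr_fun (h1.unique h2) v
  simpa using h3

/-- The map `x ↦ N x • G x`, where `G` is the normalized gradient, extends the Gauss map; its
derivative is injective as soon as the tangential derivative of the Gauss map is. -/
theorem injective_fderiv_smul_normalizedGradient (hN : IsC2Norm N)
    {x : EuclideanSpace ℝ (Fin 2)} (hx : N x = 1)
    (h : ∀ v, ⟪gradient N x, v⟫ = 0 → fderiv ℝ (normalizedGradient N) x v = 0 → v = 0) :
    Function.Injective (fderiv ℝ (fun y ↦ N y • normalizedGradient N y) x) := by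
  have hx0 := hN.ne_zero hx
  have h1 := (hN.hasGradientAt hx0).hasFDerivAt
  have h2 := ((hN.contDiffAt_normalizedGradient hx0).differentiableAt one_ne_zero).hasFDerivAt
  have h3 := h1.smul h2
  rw [show fderiv ℝ (fun y ↦ N y • normalizedGradient N y) x = _ from h3.fderiv]
  refine (injective_iff_map_eq_zero _).2 fun v hv ↦ ?_
  have hv' : fderiv ℝ (normalizedGradient N) x v
      + ⟪gradient N x, v⟫ • normalizedGradient N x = 0 := by simpa [hx] using hv
  have h4 := congrArg (fun w ↦ ⟪normalizedGradient N x, w⟫) hv'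
  simp only [inner_add_right, hN.inner_normalizedGradient_fderiv hx0, real_inner_smul_right,
    real_inner_self_eq_norm_sq, hN.norm_normalizedGradient hx0, inner_zero_right] at h4
  have h5 : ⟪gradient N x, v⟫ = 0 := by simpa using h4
  exact h v h5 (by simpa [h5] using hv')

/-- Any left inverse of the Gauss map is `C¹` where the tangential derivative of the Gauss map is
injective. -/
theorem contDiffWithinAt_leftInverse (hN : IsC2Norm N) {x : EuclideanSpace ℝ (Fin 2)}
    (hx : N x = 1)
    (h : ∀ v, ⟪gradient N x, v⟫ = 0 → fderiv ℝ (normalizedGradient N) x v = 0 → v = 0)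
    {g : EuclideanSpace ℝ (Fin 2) → EuclideanSpace ℝ (Fin 2)}
    (hg : ∀ y, N y = 1 → g (normalizedGradient N y) = y) :
    ContDiffWithinAt ℝ 1 g (sphere 0 1) (normalizedGradient N x) := by
  have hx0 := hN.ne_zero hx
  set F : EuclideanSpace ℝ (Fin 2) → EuclideanSpace ℝ (Fin 2) :=
    fun y ↦ N y • normalizedGradient N y with hF
  have hFx : F x = normalizedGradient N x := by simp [hF, hx]
  have hFc : ContDiffAt ℝ 1 F x :=
    ((hN.contDiffAt hx0).of_le (by norm_num)).smul (hN.contDiffAt_normalizedGradient hx0)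
  have hinj := hN.injective_fderiv_smul_normalizedGradient hx h
  let e := (LinearEquiv.ofInjectiveEndo
    (fderiv ℝ F x : EuclideanSpace ℝ (Fin 2) →ₗ[ℝ] _) hinj).toContinuousLinearEquiv
  have hFe : HasFDerivAt F (e : EuclideanSpace ℝ (Fin 2) →L[ℝ] _) x := by
    rw [show (e : EuclideanSpace ℝ (Fin 2) →L[ℝ] _) = fderiv ℝ F x from
      ContinuousLinearMap.ext fun _ ↦ rfl]
    exact (hFc.differentiableAt one_ne_zero).hasFDerivAt
  have hloc := hFc.to_localInverse hFe one_ne_zero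
  let φ := hFc.localInverse hFe one_ne_zero
  have hφx : φ (F x) = x := hFc.localInverse_apply_image hFe one_ne_zero
  have hright : ∀ᶠ q in nhds (F x), F (φ q) = q :=
    (hFc.hasStrictFDerivAt' hFe one_ne_zero).eventually_right_inverse
  have hne : ∀ᶠ q in nhds (F x), φ q ≠ 0 := by
    refine hloc.continuousAt.eventually_ne ?_
    change φ (F x) ≠ 0
    rwa [hφx]
  have heq : ∀ᶠ q in nhdsWithin (F x) (sphere 0 1), g q = φ q := by
    filter_upwards [hright.filter_mono nhdsWithin_le_nhds, hne.filter_mono nhdsWithin_le_nhds,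
      eventually_mem_nhdsWithin] with q hq hq0 hq1
    have hN1 : N (φ q) = 1 := by
      have h1 : ‖F (φ q)‖ = 1 := by rw [hq]; simpa using hq1
      rwa [hF, norm_smul, hN.norm_normalizedGradient hq0, mul_one, Real.norm_eq_abs,
        abs_of_nonneg (hN.nonneg _)] at h1
    have h2 : normalizedGradient N (φ q) = q := by simpa [hF, hN1] using hq
    have h3 := hg _ hN1
    rwa [h2] at h3
  rw [← hFx]
  refine hloc.contDiffWithinAt.congr_of_eventuallyEq heq (heq.self_of_nhdsWithin ?_)
  rw [hFx]
  simp [hN.norm_normalizedGradient hx0]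

end IsC2Norm

/-- `γ` is a periodic arc-length `C²` parametrization of the unit circle of `N`. -/
structure IsArcLengthParametrization (N : EuclideanSpace ℝ (Fin 2) → ℝ)
    (γ : ℝ → EuclideanSpace ℝ (Fin 2)) (L : ℝ) : Prop where
  isC2Norm : IsC2Norm N
  period_pos : 0 < L
  contDiff : ContDiff ℝ 2 γ
  periodic : ∀ t, γ (t + L) = γ t
  range_eq : range γ = {x | N x = 1}
  norm_deriv : ∀ t, ‖deriv γ t‖ = 1

namespace IsArcLengthParametrization

variable {N : EuclideanSpace ℝ (Fin 2) → ℝ} {γ : ℝ → EuclideanSpace ℝ (Fin 2)} {L : ℝ}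

theorem map_eq_one (h : IsArcLengthParametrization N γ L) (t : ℝ) : N (γ t) = 1 := by
  have : γ t ∈ {x | N x = 1} := h.range_eq ▸ mem_range_self t
  exact this

theorem ne_zero (h : IsArcLengthParametrization N γ L) (t : ℝ) : γ t ≠ 0 :=
  h.isC2Norm.ne_zero (h.map_eq_one t)

theorem exists_mem_Icc (h : IsArcLengthParametrization N γ L) {x : EuclideanSpace ℝ (Fin 2)}
    (hx : N x = 1) : ∃ t ∈ Icc 0 L, γ t = x := by
  obtain ⟨t, rfl⟩ : x ∈ range γ := h.range_eq ▸ hx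
  obtain ⟨s, hs, hst⟩ := Function.Periodic.exists_mem_Ico₀ h.periodic h.period_pos t
  exact ⟨s, Ico_subset_Icc_self hs, hst.symm⟩

theorem hasDerivAt (h : IsArcLengthParametrization N γ L) (t : ℝ) :
    HasDerivAt γ (deriv γ t) t :=
  (h.contDiff.differentiable (by norm_num) t).hasDerivAt

theorem hasDerivAt_deriv (h : IsArcLengthParametrization N γ L) (t : ℝ) :
    HasDerivAt (deriv γ) (deriv (deriv γ) t) t := by
  have h1 : ContDiff ℝ (1 + 1) γ := by simpa [one_add_one_eq_two] using h.contDiff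
  exact ((contDiff_succ_iff_deriv.1 h1).2.2.differentiable one_ne_zero t).hasDerivAt

theorem deriv_ne_zero (h : IsArcLengthParametrization N γ L) (t : ℝ) : deriv γ t ≠ 0 := by
  rw [← norm_ne_zero_iff, h.norm_deriv]
  exact one_ne_zero

theorem inner_deriv_deriv (h : IsArcLengthParametrization N γ L) (t : ℝ) :
    ⟪deriv (deriv γ) t, deriv γ t⟫ = 0 := by
  have h1 := (h.hasDerivAt_deriv t).norm_sq
  have h2 : HasDerivAt (fun s ↦ ‖deriv γ s‖ ^ 2) 0 t := by
    simpa [h.norm_deriv] using hasDerivAt_const t (1 : ℝ)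
  have h3 := h1.unique h2
  rw [real_inner_comm]
  simpa using h3

theorem inner_gradient_deriv (h : IsArcLengthParametrization N γ L) (t : ℝ) :
    ⟪gradient N (γ t), deriv γ t⟫ = 0 := by
  have h1 := (h.isC2Norm.hasGradientAt (h.ne_zero t)).hasFDerivAt.comp_hasDerivAt t
    (h.hasDerivAt t)
  have h2 : HasDerivAt (N ∘ γ) 0 t := by
    rw [show N ∘ γ = fun _ ↦ 1 from funext h.map_eq_one]
    exact hasDerivAt_const t (1 : ℝ)
  simpa using h1.unique h2

theorem inner_normalizedGradient_deriv (h : IsArcLengthParametrization N γ L) (t : ℝ) :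
    ⟪normalizedGradient N (γ t), deriv γ t⟫ = 0 := by
  rw [normalizedGradient, real_inner_smul_left, h.inner_gradient_deriv, mul_zero]

theorem hasDerivAt_normalizedGradient (h : IsArcLengthParametrization N γ L) (t : ℝ) :
    HasDerivAt (fun s ↦ normalizedGradient N (γ s))
      (fderiv ℝ (normalizedGradient N) (γ t) (deriv γ t)) t :=
  ((h.isC2Norm.contDiffAt_normalizedGradient (h.ne_zero t)).differentiableAt
    one_ne_zero).hasFDerivAt.comp_hasDerivAt t (h.hasDerivAt t)

theorem inner_fderiv_normalizedGradient (h : IsArcLengthParametrization N γ L) (t : ℝ) :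
    ⟪normalizedGradient N (γ t), deriv (deriv γ) t⟫
      + ⟪fderiv ℝ (normalizedGradient N) (γ t) (deriv γ t), deriv γ t⟫ = 0 := by
  have h1 := (h.hasDerivAt_normalizedGradient t).inner ℝ (h.hasDerivAt_deriv t)
  have h2 : HasDerivAt (fun s ↦ ⟪normalizedGradient N (γ s), deriv γ s⟫) 0 t := by
    simpa [h.inner_normalizedGradient_deriv] using hasDerivAt_const t (0 : ℝ)
  exact h1.unique h2

theorem normalizedGradient_ne_zero (h : IsArcLengthParametrization N γ L) (t : ℝ) :
    normalizedGradient N (γ t) ≠ 0 := by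
  rw [← norm_ne_zero_iff, h.isC2Norm.norm_normalizedGradient (h.ne_zero t)]
  exact one_ne_zero

theorem fderiv_normalizedGradient_eq_zero_iff (h : IsArcLengthParametrization N γ L) (t : ℝ) :
    fderiv ℝ (normalizedGradient N) (γ t) (deriv γ t) = 0 ↔ deriv (deriv γ) t = 0 := by
  have h0 := h.inner_fderiv_normalizedGradient t
  constructor
  · intro h1
    rw [h1, inner_zero_left, add_zero] at h0
    exact eq_zero_of_inner_eq_zero_of_inner_eq_zero (h.normalizedGradient_ne_zero t)
      (h.deriv_ne_zero t) (h.inner_normalizedGradient_deriv t) (by rwa [real_inner_comm])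
      (h.inner_deriv_deriv t)
  · intro h1
    rw [h1, inner_zero_right, zero_add] at h0
    refine eq_zero_of_inner_eq_zero_of_inner_eq_zero (h.normalizedGradient_ne_zero t)
      (h.deriv_ne_zero t) (h.inner_normalizedGradient_deriv t) ?_ h0
    rw [real_inner_comm]
    exact h.isC2Norm.inner_normalizedGradient_fderiv (h.ne_zero t) _

theorem finite_setOf_inner_deriv_eq_zero (h : IsArcLengthParametrization N γ L)
    (hc : ∀ t, deriv (deriv γ) t ≠ 0) {u : EuclideanSpace ℝ (Fin 2)} (hu : u ≠ 0) :
    {t ∈ Icc 0 L | ⟪u, deriv γ t⟫ = 0}.Finite := by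
  by_contra hinf
  obtain ⟨t, -, ht⟩ := Set.Infinite.exists_accPt_of_subset_isCompact hinf isCompact_Icc
    (sep_subset _ _)
  have hcont : Continuous fun s ↦ ⟪u, deriv γ s⟫ :=
    continuous_const.inner (continuous_iff_continuousAt.2 fun s ↦
      (h.hasDerivAt_deriv s).continuousAt)
  have hfreq := accPt_iff_frequently_nhdsNE.1 ht
  have h0 : ⟪u, deriv γ t⟫ = 0 := by
    have hcl : IsClosed {s | ⟪u, deriv γ s⟫ = 0} := isClosed_eq hcont continuous_const
    exact hcl.mem_of_frequently_of_tendsto (hfreq.mono fun s hs ↦ hs.2)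
      (Filter.tendsto_id.mono_left nhdsWithin_le_nhds)
  have hd : HasDerivAt (fun s ↦ ⟪u, deriv γ s⟫) ⟪u, deriv (deriv γ) t⟫ t := by
    simpa using (hasDerivAt_const t u).inner ℝ (h.hasDerivAt_deriv t)
  have hne : ⟪u, deriv (deriv γ) t⟫ ≠ 0 :=
    inner_ne_zero_of_inner_eq_zero (h.deriv_ne_zero t) (hc t) hu
      (by rw [real_inner_comm]; exact h.inner_deriv_deriv t) h0
  obtain ⟨s, hs1, hs2⟩ := (hfreq.and_eventually (hd.eventually_ne (c := 0) hne)).exists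
  exact hs2 hs1.2

theorem eq_of_inner_gradient_eq_one (h : IsArcLengthParametrization N γ L)
    (hc : ∀ t, deriv (deriv γ) t ≠ 0) {x y : EuclideanSpace ℝ (Fin 2)} (hx : N x = 1)
    (hy : N y ≤ 1) (hxy : ⟪gradient N x, y⟫ = 1) : y = x := by
  by_contra hne
  have hx0 := h.isC2Norm.ne_zero hx
  refine ((Icc_infinite (zero_lt_one' ℝ)).image
    (AffineMap.lineMap_injective ℝ (Ne.symm hne)).injOn) ?_
  refine ((h.finite_setOf_inner_deriv_eq_zero hc
    (h.isC2Norm.gradient_ne_zero hx0)).image γ).subset ?_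
  rintro _ ⟨s, ⟨hs0, hs1⟩, rfl⟩
  rw [AffineMap.lineMap_apply_module]
  have hin : ⟪gradient N x, (1 - s) • x + s • y⟫ = 1 := by
    rw [inner_add_right, real_inner_smul_right, real_inner_smul_right, hxy,
      h.isC2Norm.inner_gradient_self hx0, hx]
    ring
  have hN1 : N ((1 - s) • x + s • y) = 1 := by
    refine le_antisymm ?_ (hin.ge.trans (h.isC2Norm.inner_gradient_le hx0 _))
    refine (h.isC2Norm.add_le _ _).trans ?_
    rw [h.isC2Norm.smul, h.isC2Norm.smul, abs_of_nonneg hs0, abs_of_nonneg (by linarith), hx]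
    nlinarith
  obtain ⟨t, ht, hts⟩ := h.exists_mem_Icc hN1
  refine ⟨t, ⟨ht, ?_⟩, hts⟩
  have hd : HasDerivAt (fun s ↦ ⟪gradient N x, γ s⟫) ⟪gradient N x, deriv γ t⟫ t := by
    simpa using (hasDerivAt_const t (gradient N x)).inner ℝ (h.hasDerivAt t)
  refine IsLocalMax.hasDerivAt_eq_zero (Filter.Eventually.of_forall fun r ↦ ?_) hd
  rw [hts, hin, ← h.map_eq_one r]
  exact h.isC2Norm.inner_gradient_le hx0 _

theorem injOn_normalizedGradient (h : IsArcLengthParametrization N γ L)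
    (hc : ∀ t, deriv (deriv γ) t ≠ 0) : InjOn (normalizedGradient N) {x | N x = 1} := by
  intro x hx y hy hxy
  have hN := h.isC2Norm
  have hx0 := hN.ne_zero hx
  have hy0 := hN.ne_zero hy
  have hx1 : N x = 1 := hx
  have hy1 : N y = 1 := hy
  have hxg := norm_pos_iff.2 (hN.gradient_ne_zero hx0)
  have hyg := norm_pos_iff.2 (hN.gradient_ne_zero hy0)
  have a1 := hN.inner_gradient_self hx0
  have a2 := hN.inner_gradient_self hy0
  have a3 := hN.inner_gradient_le hx0 y
  have a4 := hN.inner_gradient_le hy0 x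
  rw [← hN.norm_smul_normalizedGradient hx0, real_inner_smul_left] at a1 a3
  rw [← hN.norm_smul_normalizedGradient hy0, real_inner_smul_left] at a2 a4
  rw [← hxy] at a2 a4
  rw [hx1] at a1 a4
  rw [hy1] at a2 a3
  have hle : ‖gradient N x‖ = ‖gradient N y‖ := by
    have hp : 0 < ⟪normalizedGradient N x, x⟫ := by
      by_contra hcon; nlinarith
    have hq : 0 < ⟪normalizedGradient N x, y⟫ := by
      by_contra hcon; nlinarith
    exact le_antisymm (le_of_mul_le_mul_right (a3.trans a2.ge) hq)
      (le_of_mul_le_mul_right (a4.trans a1.ge) hp)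
  refine (h.eq_of_inner_gradient_eq_one hc hx hy1.le ?_).symm
  rw [← hN.norm_smul_normalizedGradient hx0, real_inner_smul_left, hle, a2]

theorem surjOn_normalizedGradient (h : IsArcLengthParametrization N γ L) :
    SurjOn (normalizedGradient N) {x | N x = 1} (sphere 0 1) := by
  intro u hu
  have hu1 : ‖u‖ = 1 := by simpa using hu
  have hu0 : u ≠ 0 := by rintro rfl; simp at hu1
  have hN := h.isC2Norm
  have hcont : Continuous fun s ↦ ⟪u, γ s⟫ := continuous_const.inner h.contDiff.continuous
  obtain ⟨t, -, ht⟩ := isCompact_Icc.exists_isMaxOn (nonempty_Icc.2 h.period_pos.le)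
    hcont.continuousOn
  have hmax : ∀ x, N x = 1 → ⟪u, x⟫ ≤ ⟪u, γ t⟫ := by
    intro x hx
    obtain ⟨s, hs, rfl⟩ := h.exists_mem_Icc hx
    exact ht hs
  have hpos : 0 < ⟪u, γ t⟫ := by
    have hNu := hN.pos hu0
    refine lt_of_lt_of_le ?_ (hmax ((N u)⁻¹ • u) ?_)
    · rw [real_inner_smul_right]
      exact mul_pos (inv_pos.2 hNu) (real_inner_self_pos.2 hu0)
    · rw [hN.smul, abs_of_pos (inv_pos.2 hNu), inv_mul_cancel₀ hNu.ne']
  have hd : HasDerivAt (fun s ↦ ⟪u, γ s⟫) ⟪u, deriv γ t⟫ t := by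
    simpa using (hasDerivAt_const t u).inner ℝ (h.hasDerivAt t)
  have hort : ⟪u, deriv γ t⟫ = 0 :=
    IsLocalMax.hasDerivAt_eq_zero
      (Filter.Eventually.of_forall fun r ↦ hmax _ (h.map_eq_one r)) hd
  refine ⟨γ t, h.map_eq_one t, ?_⟩
  have hn := hN.norm_normalizedGradient (h.ne_zero t)
  have hrep := eq_inner_smul_of_inner_eq_zero (h.deriv_ne_zero t) hn
    (by rw [real_inner_comm]; exact h.inner_normalizedGradient_deriv t) hort
  set c := ⟪u, normalizedGradient N (γ t)⟫
  have hG : 0 < ⟪normalizedGradient N (γ t), γ t⟫ := by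
    rw [normalizedGradient, real_inner_smul_left, hN.inner_gradient_self (h.ne_zero t),
      h.map_eq_one, mul_one]
    exact inv_pos.2 (norm_pos_iff.2 (hN.gradient_ne_zero (h.ne_zero t)))
  have hcpos : 0 < c := by
    rw [hrep, real_inner_smul_left] at hpos
    exact pos_of_mul_pos_left hpos hG.le
  have hc1 : c = 1 := by
    have h1 := hu1
    rwa [hrep, norm_smul, hn, mul_one, Real.norm_eq_abs, abs_of_pos hcpos] at h1
  rw [hrep, hc1, one_smul]

theorem bijOn_normalizedGradient (h : IsArcLengthParametrization N γ L)
    (hc : ∀ t, deriv (deriv γ) t ≠ 0) :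
    BijOn (normalizedGradient N) {x | N x = 1} (sphere 0 1) :=
  ⟨fun _ hx ↦ by simp [h.isC2Norm.norm_normalizedGradient (h.isC2Norm.ne_zero hx)],
    h.injOn_normalizedGradient hc, h.surjOn_normalizedGradient⟩

theorem contDiffOn_leftInverse (h : IsArcLengthParametrization N γ L)
    (hc : ∀ t, deriv (deriv γ) t ≠ 0)
    {g : EuclideanSpace ℝ (Fin 2) → EuclideanSpace ℝ (Fin 2)}
    (hg : LeftInvOn g (normalizedGradient N) {x | N x = 1}) :
    ContDiffOn ℝ 1 g (sphere 0 1) := by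
  intro q hq
  obtain ⟨x, hx, rfl⟩ := h.surjOn_normalizedGradient hq
  obtain ⟨t, -, rfl⟩ := h.exists_mem_Icc hx
  refine h.isC2Norm.contDiffWithinAt_leftInverse hx (fun v hv hv' ↦ ?_) fun y hy ↦ hg hy
  have hrep := eq_inner_smul_of_inner_eq_zero (h.isC2Norm.gradient_ne_zero (h.ne_zero t))
    (h.norm_deriv t) (h.inner_gradient_deriv t) (by rwa [real_inner_comm])
  rw [hrep, map_smul, smul_eq_zero, h.fderiv_normalizedGradient_eq_zero_iff] at hv'
  rw [hrep, hv'.resolve_right (hc t), zero_smul]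

theorem deriv_deriv_ne_zero_of_leftInverse (h : IsArcLengthParametrization N γ L)
    {g : EuclideanSpace ℝ (Fin 2) → EuclideanSpace ℝ (Fin 2)}
    (hg : LeftInvOn g (normalizedGradient N) {x | N x = 1})
    (hgc : ContDiffOn ℝ 1 g (sphere 0 1)) (t : ℝ) : deriv (deriv γ) t ≠ 0 := by
  refine (h.fderiv_normalizedGradient_eq_zero_iff t).not.1 fun h0 ↦ ?_
  have hmem : ∀ s, normalizedGradient N (γ s) ∈ sphere (0 : EuclideanSpace ℝ (Fin 2)) 1 :=
    fun s ↦ by simp [h.isC2Norm.norm_normalizedGradient (h.ne_zero s)]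
  have h1 := (hgc.differentiableOn one_ne_zero _ (hmem t)).hasFDerivWithinAt
  have h2 := h1.comp_hasDerivAt t (h.hasDerivAt_normalizedGradient t)
    (Filter.Eventually.of_forall hmem)
  rw [h0, map_zero,
    show (g ∘ fun s ↦ normalizedGradient N (γ s)) = γ from
      funext fun s ↦ hg (h.map_eq_one s)] at h2
  exact h.deriv_ne_zero t h2.deriv

end IsArcLengthParametrization

/-- for a norm `N` on ℝ² of class `C²` away from `0`, with `γ` the
periodic counterclockwise arc-length `C²`-parametrization of the `N`-unit
circle, the Gauss map `G x = ∇N(x)/‖∇N(x)‖` is a `C¹`-diffeomorphism from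
`∂B_N(0,1)` onto `S¹` if and only if `γ'' ≠ 0` everywhere; moreover in that case
`B_N(0,1)` is strictly convex. -/
theorem gauss_map_diffeo_iff_curvature_ne_zero
    (N : EuclideanSpace ℝ (Fin 2) → ℝ)
    (hN_add : ∀ x y : EuclideanSpace ℝ (Fin 2), N (x + y) ≤ N x + N y)
    (hN_smul : ∀ (c : ℝ) (x : EuclideanSpace ℝ (Fin 2)), N (c • x) = |c| * N x)
    (hN_zero : ∀ x : EuclideanSpace ℝ (Fin 2), N x = 0 → x = 0)
    (hN_C2 : ContDiffOn ℝ 2 N ({0}ᶜ : Set (EuclideanSpace ℝ (Fin 2))))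
    -- `γ` is the periodic arc-length `C²`-parametrization of the `N`-unit circle:
    (γ : ℝ → EuclideanSpace ℝ (Fin 2)) (L : ℝ) (hL : 0 < L)
    (hγ_C2 : ContDiff ℝ 2 γ)
    (hγ_per : ∀ t, γ (t + L) = γ t)
    (hγ_range : Set.range γ = {x : EuclideanSpace ℝ (Fin 2) | N x = 1})
    (hγ_unit : ∀ t, ‖deriv γ t‖ = 1) :
    ((∃ Ginv : EuclideanSpace ℝ (Fin 2) → EuclideanSpace ℝ (Fin 2),
        Set.BijOn (fun x : EuclideanSpace ℝ (Fin 2) => ‖gradient N x‖⁻¹ • gradient N x)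
          {x : EuclideanSpace ℝ (Fin 2) | N x = 1}
          (sphere (0 : EuclideanSpace ℝ (Fin 2)) 1) ∧
        ContDiffOn ℝ 1
          (fun x : EuclideanSpace ℝ (Fin 2) => ‖gradient N x‖⁻¹ • gradient N x)
          {x : EuclideanSpace ℝ (Fin 2) | N x = 1} ∧
        Set.InvOn Ginv
          (fun x : EuclideanSpace ℝ (Fin 2) => ‖gradient N x‖⁻¹ • gradient N x)
          {x : EuclideanSpace ℝ (Fin 2) | N x = 1}
          (sphere (0 : EuclideanSpace ℝ (Fin 2)) 1) ∧
        ContDiffOn ℝ 1 Ginv (sphere (0 : EuclideanSpace ℝ (Fin 2)) 1)) ↔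
      (∀ t, deriv (deriv γ) t ≠ 0)) ∧
    ((∀ t, deriv (deriv γ) t ≠ 0) →
      ∀ x : EuclideanSpace ℝ (Fin 2), N x = 1 →
        ∃ u : EuclideanSpace ℝ (Fin 2), u ≠ 0 ∧
          (∀ y : EuclideanSpace ℝ (Fin 2), N y ≤ 1 → ⟪u, y⟫ ≤ ⟪u, x⟫) ∧
          (∀ y : EuclideanSpace ℝ (Fin 2), N y ≤ 1 → ⟪u, y⟫ = ⟪u, x⟫ → y = x)) := by
  have h : IsArcLengthParametrization N γ L :=
    ⟨⟨hN_add, hN_smul, hN_zero, hN_C2⟩, hL, hγ_C2, hγ_per, hγ_range, hγ_unit⟩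
  refine ⟨⟨?_, fun hc ↦ ?_⟩, fun hc x hx ↦ ?_⟩
  · rintro ⟨g, -, -, hinv, hg⟩
    exact h.deriv_deriv_ne_zero_of_leftInverse hinv.1 hg
  · have hbij := h.bijOn_normalizedGradient hc
    have hinv := hbij.invOn_invFunOn
    exact ⟨_, hbij, fun x hx ↦ (h.isC2Norm.contDiffAt_normalizedGradient
      (h.isC2Norm.ne_zero hx)).contDiffWithinAt, hinv, h.contDiffOn_leftInverse hc hinv.1⟩
  · have hx0 := h.isC2Norm.ne_zero hx
    have hself := (h.isC2Norm.inner_gradient_self hx0).trans hx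
    refine ⟨gradient N x, h.isC2Norm.gradient_ne_zero hx0, fun y hy ↦ ?_, fun y hy hxy ↦ ?_⟩
    · exact hself ▸ (h.isC2Norm.inner_gradient_le hx0 y).trans hy
    · exact h.eq_of_inner_gradient_eq_one hc hx hy (hxy.trans hself)
end
end
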